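/- Let S ⊆ ℝ² be a convex compact set, X ⊆ ℝ² a finite point set, and k a positive integer with k ≤ |X|. Then the number of hyperedges of the k-uniform S-capturing hypergraph ℋ(X,S,k), i.e., the number of k-element subsets Y ⊆ X for which there exists an S-range S' with X ∩ S' = Y, is at most (2k−1)·|X| − k² + 1 − Σ_{i=1}^{k−1} a_i. -/

import Mathlib

open Set

noncomputable section

/-- The Euclidean plane. -/
abbrev Pt : Type := EuclideanSpace ℝ (Fin 2)

/-- `T` is an `S`-range: a homothetic copy of `S` with positive ratio. -/
def IsRange (S T : Set Pt) : Prop :=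
  ∃ (c : ℝ) (v : Pt), 0 < c ∧ T = (fun x => c • x + v) '' S

/-- A straight line in the plane. -/
def IsLine (l : Set Pt) : Prop :=
  ∃ (f : Pt →ₗ[ℝ] ℝ) (a : ℝ), f ≠ 0 ∧ l = {x | f x = a}

/-- A closed halfplane. -/
def IsClosedHalfplane (H : Set Pt) : Prop :=
  ∃ (f : Pt →ₗ[ℝ] ℝ) (a : ℝ), f ≠ 0 ∧ H = {x | f x ≤ a}

/-- An open halfplane bounded by the line through `p` and `q`. -/
def IsOpenHalfplaneOf (p q : Pt) (L : Set Pt) : Prop :=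
  ∃ (f : Pt →ₗ[ℝ] ℝ) (a : ℝ), f ≠ 0 ∧ f p = a ∧ f q = a ∧ L = {x | a < f x}

/-- `S` is a nice shape: a non-empty convex compact set such that every boundary
point has exactly one touching line and the boundary contains no non-trivial
straight line segment. -/
def NiceShape (S : Set Pt) : Prop :=
  S.Nonempty ∧ Convex ℝ S ∧ IsCompact S ∧
  (∀ p ∈ frontier S, ∃! l : Set Pt, IsLine l ∧ l ∩ S = {p}) ∧
  (∀ x ∈ frontier S, ∀ y ∈ frontier S, segment ℝ x y ⊆ frontier S → x = y)

/-- No four points of `A` lie on the boundary of a common `S`-range. -/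
def NoFourOnBoundary (S A : Set Pt) : Prop :=
  ∀ T : Set Pt, IsRange S T →
    ∀ p₁ p₂ p₃ p₄ : Pt, p₁ ∈ A ∩ frontier T → p₂ ∈ A ∩ frontier T →
      p₃ ∈ A ∩ frontier T → p₄ ∈ A ∩ frontier T →
      p₁ ≠ p₂ → p₁ ≠ p₃ → p₁ ≠ p₄ → p₂ ≠ p₃ → p₂ ≠ p₄ → p₃ ≠ p₄ → False

/-- `X` is in general position with respect to `S`: no two points on a vertical
line, no three points collinear, and no four points on the boundary of a common
`S`-range. -/
def GenPos (S : Set Pt) (X : Finset Pt) : Prop :=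
  (∀ p ∈ X, ∀ q ∈ X, p ≠ q → p 0 ≠ q 0) ∧
  (∀ p ∈ X, ∀ q ∈ X, ∀ r ∈ X, p ≠ q → p ≠ r → q ≠ r →
    ¬ Collinear ℝ ({p, q, r} : Set Pt)) ∧
  NoFourOnBoundary S ↑X

/-- The hyperedges of the `k`-uniform `S`-capturing hypergraph on `X`:
`k`-element subsets of `X` captured by some `S`-range. -/
def capturedSets (S : Set Pt) (X : Finset Pt) (k : ℕ) : Set (Set Pt) :=
  {Y | Y ⊆ ↑X ∧ Y.ncard = k ∧ ∃ T : Set Pt, IsRange S T ∧ ↑X ∩ T = Y}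

/-- The `i`-sets of `X`: `i`-element subsets of `X` separable by a straight line,
i.e. captured by a closed halfplane.  `aᵢ` is the number of such sets. -/
def iSets (X : Finset Pt) (i : ℕ) : Set (Set Pt) :=
  {Y | Y ⊆ ↑X ∧ Y.ncard = i ∧ ∃ H : Set Pt, IsClosedHalfplane H ∧ ↑X ∩ H = Y}

/-- `𝒜ᵢ`: closed halfplanes containing exactly `i` points of `X`, exactly two of
which lie on the boundary line. -/
def repHalfplanes (X : Finset Pt) (i : ℕ) : Set (Set Pt) :=
  {H | IsClosedHalfplane H ∧ ((↑X : Set Pt) ∩ H).ncard = i ∧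
    ((↑X : Set Pt) ∩ frontier H).ncard = 2}

/-- `𝒮_pq`: the `S`-ranges having both `p` and `q` on their boundary. -/
def rangesThrough (S : Set Pt) (p q : Pt) : Set (Set Pt) :=
  {T | IsRange S T ∧ p ∈ frontier T ∧ q ∈ frontier T}

/-- The ranges in `𝒮_pq` that come strictly after `S₁` (w.r.t. `≺`, i.e. inclusion
of the intersections with `L`) and have a point of `X` on their boundary that is
not on the boundary of `S₁`. -/
def nextCandidates (S : Set Pt) (p q : Pt) (L : Set Pt) (X : Finset Pt) (S₁ : Set Pt) :
    Set (Set Pt) :=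
  {S₂ | S₂ ∈ rangesThrough S p q ∧ S₁ ∩ L ⊂ S₂ ∩ L ∧
    ((frontier S₂ \ frontier S₁) ∩ ↑X).Nonempty}

/-- `ℛ₁ᵏ`: Type I ranges, i.e. `S`-ranges containing exactly `k` points of `X`,
exactly three of which are on the boundary. -/
def typeIRanges (S : Set Pt) (X : Finset Pt) (k : ℕ) : Set (Set Pt) :=
  {T | IsRange S T ∧ ((↑X : Set Pt) ∩ T).ncard = k ∧
    ((↑X : Set Pt) ∩ frontier T).ncard = 3}

/-- `ℛ(Y)`: the Type I representative ranges of `Y`. -/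
def repRanges (S : Set Pt) (X : Finset Pt) (Y : Set Pt) : Set (Set Pt) :=
  {T | IsRange S T ∧ ↑X ∩ T = Y ∧ ((↑X : Set Pt) ∩ frontier T).ncard = 3}

/-- `ℰ₁ᵏ`: Type I hyperedges. -/
def typeIEdges (S : Set Pt) (X : Finset Pt) (k : ℕ) : Set (Set Pt) :=
  {Y | Y ⊆ ↑X ∧ Y.ncard = k ∧ (repRanges S X Y).Nonempty}

/-- `ℰ₂ᵏ`: Type II hyperedges, captured by some `S`-range but by no `S`-range with
three points of `X` on its boundary. -/
def typeIIEdges (S : Set Pt) (X : Finset Pt) (k : ℕ) : Set (Set Pt) :=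
  {Y | Y ∈ capturedSets S X k ∧ ¬ (repRanges S X Y).Nonempty}

/-- A `C¹` strictly convex function whose sublevel set `{φ ≤ 1}` is a convex body. The ranges of
this body are the sets `{x | φ (σ • x + w) ≤ 1}` with `0 < σ`. -/
structure IsSmoothGauge (φ : Pt → ℝ) : Prop where
  contDiff : ContDiff ℝ 1 φ
  strictConvex : StrictConvexOn ℝ univ φ
  bounded : ∃ r, ∀ x, φ x ≤ 1 → ‖x‖ ≤ r
  exists_lt_one : ∃ z, φ z < 1

/-- The first basis vector of the plane. -/
def xDir : Pt := EuclideanSpace.single 0 1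

/-- The second basis vector of the plane. -/
def yDir : Pt := EuclideanSpace.single 1 1

@[simp] lemma xDir_zero : xDir 0 = 1 := by simp [xDir]
@[simp] lemma xDir_one : xDir 1 = 0 := by simp [xDir]
@[simp] lemma yDir_zero : yDir 0 = 0 := by simp [yDir]
@[simp] lemma yDir_one : yDir 1 = 1 := by simp [yDir]

lemma Pt.ext_coord {x y : Pt} (h0 : x 0 = y 0) (h1 : x 1 = y 1) : x = y := by
  ext i; fin_cases i
  · exact h0
  · exact h1

lemma Pt.decomp (w : Pt) : w = w 0 • xDir + w 1 • yDir := by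
  apply Pt.ext_coord <;> simp

lemma apply_eq_coord (f : Pt →L[ℝ] ℝ) (w : Pt) : f w = w 0 * f xDir + w 1 * f yDir := by
  conv_lhs => rw [Pt.decomp w]
  simp

namespace IsSmoothGauge

variable {φ : Pt → ℝ}

lemma hasFDerivAt (hφ : IsSmoothGauge φ) (b : Pt) : HasFDerivAt φ (fderiv ℝ φ b) b :=
  (hφ.contDiff.differentiable (by norm_num) b).hasFDerivAt

lemma hasDerivAt_line (hφ : IsSmoothGauge φ) (b w : Pt) :
    HasDerivAt (fun t : ℝ => φ (b + t • w)) (fderiv ℝ φ b w) 0 := by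
  have h1 : HasDerivAt (fun t : ℝ => b + t • w) w 0 := by
    simpa using ((hasDerivAt_id (0 : ℝ)).smul_const w).const_add b
  have h2 : HasFDerivAt φ (fderiv ℝ φ b) (b + (0 : ℝ) • w) := by simpa using hφ.hasFDerivAt b
  exact h2.comp_hasDerivAt (0 : ℝ) h1

/-- The tangent plane lies strictly below the graph. -/
lemma add_fderiv_lt (hφ : IsSmoothGauge φ) {u b : Pt} (h : u ≠ b) :
    φ b + fderiv ℝ φ b (u - b) < φ u := by
  have key : ∀ v : Pt, fderiv ℝ φ b (v - b) ≤ φ v - φ b := by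
    intro v
    have hd := (hφ.hasDerivAt_line b (v - b)).hasDerivWithinAt (s := Ioi 0)
    rw [hasDerivWithinAt_iff_tendsto_slope' (by simp)] at hd
    refine le_of_tendsto hd ?_
    filter_upwards [Ioo_mem_nhdsGT (zero_lt_one' ℝ)] with t ht
    have := hφ.strictConvex.convexOn.2 (mem_univ b) (mem_univ v)
      (show 0 ≤ 1 - t by linarith [ht.2]) ht.1.le (by ring)
    have e : (1 - t) • b + t • v = b + t • (v - b) := by module
    rw [e] at this
    simp only [slope_def_field, zero_smul, add_zero, sub_zero]
    rw [div_le_iff₀ ht.1]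
    simp only [smul_eq_mul] at this
    linarith
  have hm := hφ.strictConvex.2 (mem_univ u) (mem_univ b) h
    (one_half_pos (α := ℝ)) (one_half_pos (α := ℝ)) (by norm_num)
  have h2 := key ((1 / 2 : ℝ) • u + (1 / 2 : ℝ) • b)
  have e : (1 / 2 : ℝ) • u + (1 / 2 : ℝ) • b - b = (1 / 2 : ℝ) • (u - b) := by module
  rw [e, map_smul] at h2
  simp only [smul_eq_mul] at h2 hm
  linarith

lemma fderiv_sub_neg (hφ : IsSmoothGauge φ) {u b : Pt} (h : u ≠ b) (hle : φ u ≤ φ b) :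
    fderiv ℝ φ b (u - b) < 0 := by
  linarith [hφ.add_fderiv_lt h]

lemma fderiv_neg_of_le (hφ : IsSmoothGauge φ) {b w : Pt} {σ : ℝ} (hσ : 0 < σ) (hw : w ≠ 0)
    (hle : φ (b + σ • w) ≤ φ b) : fderiv ℝ φ b w < 0 := by
  have := hφ.fderiv_sub_neg (u := b + σ • w) (b := b) (by simp [hσ.ne', hw]) hle
  rw [add_sub_cancel_left, map_smul, smul_eq_mul] at this
  by_contra! h
  nlinarith

lemma eventually_lt (hφ : IsSmoothGauge φ) {b w : Pt} (h : fderiv ℝ φ b w < 0) :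
    ∀ᶠ t in nhdsWithin (0 : ℝ) (Ioi 0), φ (b + t • w) < φ b := by
  have hd := (hφ.hasDerivAt_line b w).hasDerivWithinAt (s := Ioi 0)
  rw [hasDerivWithinAt_iff_tendsto_slope' (by simp)] at hd
  filter_upwards [hd.eventually (gt_mem_nhds h), self_mem_nhdsWithin] with t ht ht0
  simp only [slope_def_field, zero_smul, add_zero, sub_zero] at ht
  rw [div_lt_iff₀ ht0] at ht
  linarith

/-- Two lower boundary points on a common vertical line coincide. -/
lemma lower_unique (hφ : IsSmoothGauge φ) {b b' : Pt} (hb : φ b = 1) (hb' : φ b' = 1)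
    (hl : fderiv ℝ φ b yDir < 0) (hl' : fderiv ℝ φ b' yDir < 0) (h0 : b 0 = b' 0) : b = b' := by
  by_contra hne
  have h1 := hφ.fderiv_sub_neg (Ne.symm hne) (hb'.trans hb.symm).le
  have h2 := hφ.fderiv_sub_neg hne (hb.trans hb'.symm).le
  rw [apply_eq_coord] at h1 h2
  simp only [PiLp.sub_apply, h0, sub_self, zero_mul, zero_add] at h1 h2
  nlinarith

/-- Slopes of tangents increase along the lower boundary arc: a direction to the left that is
weakly inward at a boundary point is inward at every boundary point further to the right. -/
lemma inward_left (hφ : IsSmoothGauge φ) {b b' w : Pt} (hb : φ b = 1) (hb' : φ b' = 1)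
    (hl : fderiv ℝ φ b yDir < 0) (hl' : fderiv ℝ φ b' yDir < 0) (h0 : b' 0 < b 0)
    (hw : w 0 < 0) (h : fderiv ℝ φ b' w ≤ 0) : fderiv ℝ φ b w < 0 := by
  have hne : b ≠ b' := by rintro rfl; exact lt_irrefl _ h0
  have h1 := hφ.fderiv_sub_neg (Ne.symm hne) (hb'.trans hb.symm).le
  have h2 := hφ.fderiv_sub_neg hne (hb.trans hb'.symm).le
  rw [apply_eq_coord] at h1 h2 h ⊢
  simp only [PiLp.sub_apply] at h1 h2
  set A := fderiv ℝ φ b xDir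
  set B := fderiv ℝ φ b yDir
  set A' := fderiv ℝ φ b' xDir
  set B' := fderiv ℝ φ b' yDir
  have hq : 0 < (b 0 - b' 0) * w 1 - w 0 * (b 1 - b' 1) := by
    have : ((b 0 - b' 0) * w 1 - w 0 * (b 1 - b' 1)) * B' < 0 := by nlinarith
    nlinarith
  have : (b 0 - b' 0) * (w 0 * A + w 1 * B) < 0 := by nlinarith
  nlinarith

/-- Mirror image of `inward_left`. -/
lemma inward_right (hφ : IsSmoothGauge φ) {b b' w : Pt} (hb : φ b = 1) (hb' : φ b' = 1)
    (hl : fderiv ℝ φ b yDir < 0) (hl' : fderiv ℝ φ b' yDir < 0) (h0 : b' 0 < b 0)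
    (hw : 0 < w 0) (h : fderiv ℝ φ b w ≤ 0) : fderiv ℝ φ b' w < 0 := by
  have hne : b ≠ b' := by rintro rfl; exact lt_irrefl _ h0
  have h1 := hφ.fderiv_sub_neg (Ne.symm hne) (hb'.trans hb.symm).le
  have h2 := hφ.fderiv_sub_neg hne (hb.trans hb'.symm).le
  rw [apply_eq_coord] at h1 h2 h ⊢
  simp only [PiLp.sub_apply] at h1 h2
  set A := fderiv ℝ φ b xDir
  set B := fderiv ℝ φ b yDir
  set A' := fderiv ℝ φ b' xDir
  set B' := fderiv ℝ φ b' yDir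
  have hq : 0 < (b 0 - b' 0) * w 1 - w 0 * (b 1 - b' 1) := by
    have : ((b 0 - b' 0) * w 1 - w 0 * (b 1 - b' 1)) * B < 0 := by nlinarith
    nlinarith
  have : (b 0 - b' 0) * (w 0 * A' + w 1 * B') < 0 := by nlinarith
  nlinarith

/-- A point that is a nontrivial convex combination of three other points of `{φ ≤ 1}` lies in
`{φ < 1}`. -/
lemma lt_one_of_combination (hφ : IsSmoothGauge φ) {v u₁ u₂ u₃ : Pt} {c₁ c₂ c₃ : ℝ}
    (h₁ : φ u₁ ≤ 1) (h₂ : φ u₂ ≤ 1) (h₃ : φ u₃ ≤ 1) (hc₁ : 0 < c₁) (hc₂ : 0 ≤ c₂) (hc₃ : 0 ≤ c₃)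
    (hne₁ : u₁ ≠ v) (hne₂ : u₂ ≠ v) (hne₃ : u₃ ≠ v)
    (h : c₁ • (u₁ - v) + c₂ • (u₂ - v) + c₃ • (u₃ - v) = 0) : φ v < 1 := by
  by_contra! hv
  have g₁ := hφ.fderiv_sub_neg hne₁ (h₁.trans hv)
  have g₂ := hφ.fderiv_sub_neg hne₂ (h₂.trans hv)
  have g₃ := hφ.fderiv_sub_neg hne₃ (h₃.trans hv)
  have := congrArg (fderiv ℝ φ v) h
  simp only [map_add, map_smul, smul_eq_mul, map_zero] at this
  nlinarith

/-- Two homothets touching at `p` from below: if, for the range with `p` at position `b`, the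
point `p + r` to the right enters no later than the point `p + l` to the left, then for every
position `b'` further to the left `p + r` enters strictly before `p + l`. -/
lemma right_before_left (hφ : IsSmoothGauge φ) {b b' l r : Pt} {σ σ' : ℝ}
    (hb : φ b = 1) (hb' : φ b' = 1)
    (hl : fderiv ℝ φ b yDir < 0) (hl' : fderiv ℝ φ b' yDir < 0) (h0 : b' 0 < b 0)
    (hσ : 0 < σ) (hσ' : 0 < σ') (hleft : l 0 < 0) (hright : 0 < r 0)
    (h₁ : φ (b + σ • r) ≤ 1) (h₂ : 1 ≤ φ (b + σ • l)) (h₃ : φ (b' + σ' • l) ≤ 1) :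
    φ (b' + σ' • r) < 1 := by
  have hl0 : l ≠ 0 := by rintro rfl; simp at hleft
  have hr0 : r ≠ 0 := by rintro rfl; simp at hright
  have hlr : l ≠ r := by rintro rfl; linarith
  have hne : b ≠ b' := by rintro rfl; exact lt_irrefl _ h0
  have d1 := hφ.fderiv_sub_neg (Ne.symm hne) (hb'.trans hb.symm).le
  have d2 := hφ.fderiv_sub_neg hne (hb.trans hb'.symm).le
  have d3 := hφ.fderiv_neg_of_le hσ hr0 (h₁.trans hb.ge)
  have d4 := hφ.fderiv_neg_of_le hσ' hl0 (h₃.trans hb'.ge)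
  have d5 := hφ.inward_right hb hb' hl hl' h0 hright d3.le
  rw [apply_eq_coord] at d1 d2 d3 d4 d5
  simp only [PiLp.sub_apply] at d1 d2
  set A := fderiv ℝ φ b xDir
  set B := fderiv ℝ φ b yDir
  set A' := fderiv ℝ φ b' xDir
  set B' := fderiv ℝ φ b' yDir
  have hC : 0 < r 0 * l 1 - r 1 * l 0 := by
    have : (r 0 * l 1 - r 1 * l 0) * B' < 0 := by nlinarith
    nlinarith
  have hα : 0 < (b 0 - b' 0) * l 1 - l 0 * (b 1 - b' 1) := by
    have : ((b 0 - b' 0) * l 1 - l 0 * (b 1 - b' 1)) * B' < 0 := by nlinarith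
    nlinarith
  have hγ : 0 < (b 0 - b' 0) * r 1 - r 0 * (b 1 - b' 1) := by
    have : ((b 0 - b' 0) * r 1 - r 0 * (b 1 - b' 1)) * B < 0 := by nlinarith
    nlinarith
  obtain ⟨C, hCdef⟩ : ∃ C, C = r 0 * l 1 - r 1 * l 0 := ⟨_, rfl⟩
  obtain ⟨α, hαdef⟩ : ∃ α, α = (b 0 - b' 0) * l 1 - l 0 * (b 1 - b' 1) := ⟨_, rfl⟩
  obtain ⟨γ, hγdef⟩ : ∃ γ, γ = (b 0 - b' 0) * r 1 - r 0 * (b 1 - b' 1) := ⟨_, rfl⟩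
  rw [← hCdef] at hC
  rw [← hαdef] at hα
  rw [← hγdef] at hγ
  have hcross : b' + σ' • l ≠ b + σ • l := by
    intro h
    have e0 := congrArg (fun v : Pt => v 0) h
    have e1 := congrArg (fun v : Pt => v 1) h
    simp only [PiLp.add_apply, PiLp.smul_apply, smul_eq_mul] at e0 e1
    have : α = 0 := by
      rw [hαdef]
      linear_combination (-l 1) * e0 + l 0 * e1
    exact hα.ne' this
  have hcross' : b + σ • r ≠ b' + σ' • r := by
    intro h
    have e0 := congrArg (fun v : Pt => v 0) h
    have e1 := congrArg (fun v : Pt => v 1) h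
    simp only [PiLp.add_apply, PiLp.smul_apply, smul_eq_mul] at e0 e1
    have : γ = 0 := by
      rw [hγdef]
      linear_combination (r 1) * e0 - r 0 * e1
    exact hγ.ne' this
  rcases le_total (C * σ + α) (γ + C * σ') with hcase | hcase
  · exfalso
    refine absurd (hφ.lt_one_of_combination h₁ h₃ hb.le (v := b + σ • l) (c₁ := α)
      (c₂ := C * σ) (c₃ := γ + C * σ' - C * σ - α) hα (by positivity) (by linarith)
      (by simp [hσ.ne', hlr.symm]) hcross (by simp [hσ.ne', hl0]) ?_) (not_lt.2 h₂)
    apply Pt.ext_coord <;>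
    · simp only [PiLp.add_apply, PiLp.smul_apply, PiLp.sub_apply, smul_eq_mul, PiLp.zero_apply]
      rw [hαdef, hγdef, hCdef]
      ring
  · refine hφ.lt_one_of_combination h₃ h₁ hb'.le (v := b' + σ' • r) (c₁ := γ)
      (c₂ := C * σ') (c₃ := α + C * σ - C * σ' - γ) hγ (by positivity) (by linarith)
      (by simp [hσ'.ne', hlr]) hcross' (by simp [hσ'.ne', hr0]) ?_
    apply Pt.ext_coord <;>
    · simp only [PiLp.add_apply, PiLp.smul_apply, PiLp.sub_apply, smul_eq_mul, PiLp.zero_apply]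
      rw [hαdef, hγdef, hCdef]
      ring

end IsSmoothGauge

/-- `level φ b σ v < 0` says that `p + v` is interior to the homothet of `{φ ≤ 1}` for which `p`
is at position `b` and the scale is `1 / σ`; for `σ = 0` the homothet is the tangent halfplane. -/
def level (φ : Pt → ℝ) (b : Pt) (σ : ℝ) (v : Pt) : ℝ :=
  if σ = 0 then fderiv ℝ φ b v else φ (b + σ • v) - 1

lemma level_zero_scale (φ : Pt → ℝ) (b v : Pt) : level φ b 0 v = fderiv ℝ φ b v := by
  simp [level]

lemma level_of_pos (φ : Pt → ℝ) (b v : Pt) {σ : ℝ} (hσ : 0 < σ) :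
    level φ b σ v = φ (b + σ • v) - 1 := by
  simp [level, hσ.ne']

lemma level_zero_vec {φ : Pt → ℝ} {b : Pt} (hb : φ b = 1) (σ : ℝ) : level φ b σ 0 = 0 := by
  by_cases h : σ = 0 <;> simp [level, h, hb]

namespace IsSmoothGauge

variable {φ : Pt → ℝ}

lemma level_lt_of_scale_lt (hφ : IsSmoothGauge φ) {b v : Pt} {σ σ' : ℝ} (hb : φ b = 1)
    (hσ : 0 ≤ σ) (hσσ' : σ < σ') (hv : v ≠ 0) (h : level φ b σ' v ≤ 0) : level φ b σ v < 0 := by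
  have hσ' : 0 < σ' := hσ.trans_lt hσσ'
  rw [level_of_pos _ _ _ hσ'] at h
  rcases hσ.eq_or_lt with rfl | hpos
  · rw [level_zero_scale]
    exact hφ.fderiv_neg_of_le hσ' hv (by linarith)
  · rw [level_of_pos _ _ _ hpos]
    have hne : b ≠ b + σ' • v := by simp [hσ'.ne', hv]
    have hlt : σ / σ' < 1 := (div_lt_one hσ').2 hσσ'
    have hm := hφ.strictConvex.2 (mem_univ b) (mem_univ _) hne
      (show 0 < 1 - σ / σ' by linarith) (div_pos hpos hσ') (by ring)
    have e : (1 - σ / σ') • b + (σ / σ') • (b + σ' • v) = b + σ • v := by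
      rw [smul_add, smul_smul, div_mul_cancel₀ _ hσ'.ne']; module
    rw [e, smul_eq_mul, smul_eq_mul, hb] at hm
    have : σ / σ' * φ (b + σ' • v) ≤ σ / σ' * 1 :=
      mul_le_mul_of_nonneg_left (by linarith) (div_pos hpos hσ').le
    linarith

lemma level_zero_nonpos (hφ : IsSmoothGauge φ) {b v : Pt} {σ : ℝ} (hb : φ b = 1)
    (hσ : 0 ≤ σ) (h : level φ b σ v ≤ 0) : level φ b 0 v ≤ 0 := by
  by_cases hv : v = 0
  · simp [hv, level]
  rcases hσ.eq_or_lt with rfl | hpos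
  · exact h
  · exact (hφ.level_lt_of_scale_lt hb le_rfl hpos hv h).le

/-- The exchange property behind the monotonicity of events. -/
lemma level_right_before_left (hφ : IsSmoothGauge φ) {b b' l r : Pt} {σ σ' : ℝ}
    (hb : φ b = 1) (hb' : φ b' = 1)
    (hl : fderiv ℝ φ b yDir < 0) (hl' : fderiv ℝ φ b' yDir < 0) (h0 : b' 0 < b 0)
    (hσ : 0 ≤ σ) (hσ' : 0 ≤ σ') (hleft : l 0 < 0) (hright : 0 < r 0)
    (h₁ : level φ b σ r ≤ 0) (h₂ : 0 ≤ level φ b σ l) (h₃ : level φ b' σ' l ≤ 0) :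
    level φ b' σ' r < 0 := by
  have h₃' := hφ.level_zero_nonpos hb' hσ' h₃
  have h₁' := hφ.level_zero_nonpos hb hσ h₁
  rw [level_zero_scale] at h₃' h₁'
  rcases hσ.eq_or_lt with rfl | hpos
  · rw [level_zero_scale] at h₂
    exact absurd (hφ.inward_left hb hb' hl hl' h0 hleft h₃') (not_lt.2 h₂)
  rcases hσ'.eq_or_lt with rfl | hpos'
  · rw [level_zero_scale]
    exact hφ.inward_right hb hb' hl hl' h0 hright h₁'
  · rw [level_of_pos _ _ _ hpos] at h₁ h₂
    rw [level_of_pos _ _ _ hpos'] at h₃ ⊢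
    have := hφ.right_before_left hb hb' hl hl' h0 hpos hpos' hleft hright
      (by linarith) (by linarith) (by linarith)
    linarith

end IsSmoothGauge

/-- An event at `p`: a homothet or tangent halfplane with `p` on its lower boundary and a further
point of `X` to the left of `p` on the boundary, containing fewer than `m` points of `X` in its
interior. A homothet must moreover have a boundary point to the right of `p` and exactly `m - 1`
interior points. -/
structure IsEvent (φ : Pt → ℝ) (X : Finset Pt) (m : ℕ) (p b : Pt) (σ : ℝ) : Prop where
  boundary : φ b = 1
  lower : fderiv ℝ φ b yDir < 0
  nonneg : 0 ≤ σ
  exists_left : ∃ y ∈ X, y 0 < p 0 ∧ level φ b σ (y - p) = 0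
  card_lt : (X.filter fun x => level φ b σ (x - p) < 0).card < m
  tie : σ = 0 ∨ (∃ z ∈ X, p 0 < z 0 ∧ level φ b σ (z - p) = 0) ∧
    (X.filter fun x => level φ b σ (x - p) < 0).card + 1 = m

/-- The interior points to the left of `p`. -/
def leftInside (φ : Pt → ℝ) (X : Finset Pt) (p b : Pt) (σ : ℝ) : Finset Pt :=
  X.filter fun x => x 0 < p 0 ∧ level φ b σ (x - p) < 0

/-- The interior points to the right of `p`. -/
def rightInside (φ : Pt → ℝ) (X : Finset Pt) (p b : Pt) (σ : ℝ) : Finset Pt :=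
  X.filter fun x => p 0 < x 0 ∧ level φ b σ (x - p) < 0

lemma card_leftInside_add_card_rightInside {φ : Pt → ℝ} {X : Finset Pt} {p b : Pt} {σ : ℝ}
    (hX : ∀ x ∈ X, x 0 = p 0 → x = p) (hb : φ b = 1) :
    (leftInside φ X p b σ).card + (rightInside φ X p b σ).card =
      (X.filter fun x => level φ b σ (x - p) < 0).card := by
  rw [← Finset.card_union_of_disjoint]
  · congr 1
    ext x
    simp only [leftInside, rightInside, Finset.mem_union, Finset.mem_filter]
    constructor
    · tauto
    · rintro ⟨hx, hlt⟩
      rcases lt_trichotomy (x 0) (p 0) with h | h | h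
      · tauto
      · rw [hX x hx h, sub_self, level_zero_vec hb] at hlt
        exact absurd hlt (lt_irrefl _)
      · tauto
  · rw [Finset.disjoint_left]
    simp only [leftInside, rightInside, Finset.mem_filter]
    rintro x ⟨_, h, _⟩ ⟨_, h', _⟩
    exact lt_asymm h h'

namespace IsEvent

variable {φ : Pt → ℝ} {X : Finset Pt} {m : ℕ} {p b b' : Pt} {σ σ' : ℝ}

lemma card_leftInside_lt (h : IsEvent φ X m p b σ) :
    (leftInside φ X p b σ).card < min m (X.filter fun x => x 0 < p 0).card := by
  refine lt_min (lt_of_le_of_lt (Finset.card_le_card ?_) h.card_lt) (Finset.card_lt_card ?_)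
  · intro x
    simp only [leftInside, Finset.mem_filter]
    tauto
  · obtain ⟨y, hy, hy0, hyl⟩ := h.exists_left
    rw [Finset.ssubset_iff_of_subset]
    · refine ⟨y, by simp [hy, hy0], by simp [leftInside, hyl]⟩
    · intro x
      simp only [leftInside, Finset.mem_filter]
      tauto

/-- Events further to the right have more interior points on the left. -/
lemma card_leftInside_lt_of_lt (hφ : IsSmoothGauge φ) (hX : ∀ x ∈ X, x 0 = p 0 → x = p)
    (h : IsEvent φ X m p b σ) (h' : IsEvent φ X m p b' σ') (hlt : b' 0 < b 0) :
    (leftInside φ X p b' σ').card < (leftInside φ X p b σ).card := by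
  by_contra! hle
  obtain ⟨y, hy, hy0, hyl⟩ := h'.exists_left
  have hyn : y ∉ leftInside φ X p b' σ' := by simp [leftInside, hyl]
  obtain ⟨x, hx, hxn⟩ : ∃ x ∈ insert y (leftInside φ X p b' σ'), x ∉ leftInside φ X p b σ := by
    by_contra! hsub
    have := Finset.card_le_card hsub
    rw [Finset.card_insert_of_notMem hyn] at this
    omega
  obtain ⟨hxX, hx0, hxl⟩ : x ∈ X ∧ x 0 < p 0 ∧ level φ b' σ' (x - p) ≤ 0 := by
    rcases Finset.mem_insert.1 hx with rfl | hx
    · exact ⟨hy, hy0, hyl.le⟩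
    · simp only [leftInside, Finset.mem_filter] at hx
      exact ⟨hx.1, hx.2.1, hx.2.2.le⟩
  have hxl' : 0 ≤ level φ b σ (x - p) := by
    by_contra! hneg
    exact hxn (by simp [leftInside, hxX, hx0, hneg])
  have hright : ∀ r : Pt, p 0 < r 0 → level φ b σ (r - p) ≤ 0 → level φ b' σ' (r - p) < 0 := by
    intro r hr hrl
    exact hφ.level_right_before_left h.boundary h'.boundary h.lower h'.lower hlt h.nonneg h'.nonneg
      (l := x - p) (by simpa using hx0) (by simpa using hr) hrl hxl' hxl
  rcases h.tie with rfl | ⟨⟨z, hz, hz0, hzl⟩, hcard⟩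
  · have := hφ.inward_left h.boundary h'.boundary h.lower h'.lower hlt (w := x - p)
      (by simpa using hx0)
      (by rw [← level_zero_scale]; exact hφ.level_zero_nonpos h'.boundary h'.nonneg hxl)
    rw [level_zero_scale] at hxl'
    linarith
  · have hzn : z ∉ rightInside φ X p b σ := by simp [rightInside, hzl]
    have hsub : insert z (rightInside φ X p b σ) ⊆ rightInside φ X p b' σ' := by
      intro r hr
      rcases Finset.mem_insert.1 hr with rfl | hr
      · simp [rightInside, hz, hz0, hright _ hz0 hzl.le]
      · simp only [rightInside, Finset.mem_filter] at hr ⊢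
        exact ⟨hr.1, hr.2.1, hright _ hr.2.1 hr.2.2.le⟩
    have h1 := Finset.card_le_card hsub
    rw [Finset.card_insert_of_notMem hzn] at h1
    have h2 := card_leftInside_add_card_rightInside (σ := σ) hX h.boundary
    have h3 := card_leftInside_add_card_rightInside (σ := σ') hX h'.boundary
    have h4 := h'.card_lt
    omega

/-- There is at most one event at each position. -/
lemma not_scale_lt (hφ : IsSmoothGauge φ) (hX : ∀ x ∈ X, x 0 = p 0 → x = p)
    (h : IsEvent φ X m p b σ) (h' : IsEvent φ X m p b σ') : ¬ σ < σ' := by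
  intro hlt
  obtain hz | ⟨-, hcard⟩ := h'.tie
  · exact absurd (h.nonneg.trans_lt hlt) (by simp [hz])
  have hsub : (X.filter fun x => level φ b σ' (x - p) < 0) ⊆
      X.filter fun x => level φ b σ (x - p) < 0 := by
    intro x hx
    simp only [Finset.mem_filter] at hx ⊢
    refine ⟨hx.1, hφ.level_lt_of_scale_lt h.boundary h.nonneg hlt ?_ hx.2.le⟩
    intro h0
    rw [h0, level_zero_vec h.boundary] at hx
    exact lt_irrefl _ hx.2
  obtain ⟨y, hy, hy0, hyl⟩ := h'.exists_left
  have hss : (X.filter fun x => level φ b σ' (x - p) < 0) ⊂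
      X.filter fun x => level φ b σ (x - p) < 0 := by
    rw [Finset.ssubset_iff_of_subset hsub]
    refine ⟨y, ?_, by simp [hyl]⟩
    simp only [Finset.mem_filter]
    refine ⟨hy, hφ.level_lt_of_scale_lt h.boundary h.nonneg hlt ?_ hyl.le⟩
    rw [sub_ne_zero]
    rintro rfl
    exact lt_irrefl _ hy0
  have h1 := Finset.card_lt_card hss
  have h2 := h.card_lt
  omega

lemma eq_of_card_leftInside_eq (hφ : IsSmoothGauge φ) (hX : ∀ x ∈ X, x 0 = p 0 → x = p)
    (h : IsEvent φ X m p b σ) (h' : IsEvent φ X m p b' σ')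
    (heq : (leftInside φ X p b σ).card = (leftInside φ X p b' σ').card) : b = b' ∧ σ = σ' := by
  have hb : b = b' := by
    refine hφ.lower_unique h.boundary h'.boundary h.lower h'.lower ?_
    rcases lt_trichotomy (b 0) (b' 0) with hlt | he | hlt
    · exact absurd heq (h'.card_leftInside_lt_of_lt hφ hX h hlt).ne
    · exact he
    · exact absurd heq (h.card_leftInside_lt_of_lt hφ hX h' hlt).ne'
  subst hb
  exact ⟨rfl, le_antisymm (not_lt.1 (h'.not_scale_lt hφ hX h)) (not_lt.1 (h.not_scale_lt hφ hX h'))⟩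

end IsEvent

lemma card_left_lt {X : Finset Pt} {p : Pt} (hp : p ∈ X) :
    (X.filter fun x => x 0 < p 0).card < X.card := by
  apply Finset.card_lt_card
  rw [Finset.ssubset_iff_of_subset (Finset.filter_subset _ _)]
  exact ⟨p, hp, by simp⟩

lemma injOn_card_left {X : Finset Pt} (hX : ∀ x ∈ X, ∀ y ∈ X, x 0 = y 0 → x = y) :
    Set.InjOn (fun p : Pt => (X.filter fun x => x 0 < p 0).card) X := by
  have key : ∀ p ∈ X, ∀ q ∈ X, p 0 < q 0 →
      (X.filter fun x => x 0 < p 0).card < (X.filter fun x => x 0 < q 0).card := by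
    intro p hp q hq hlt
    apply Finset.card_lt_card
    rw [Finset.ssubset_iff_of_subset]
    · exact ⟨p, by simp [hp, hlt], by simp⟩
    · intro x hx
      simp only [Finset.mem_filter] at hx ⊢
      exact ⟨hx.1, hx.2.trans hlt⟩
  intro p hp q hq heq
  rcases lt_trichotomy (p 0) (q 0) with h | h | h
  · exact absurd heq (key p hp q hq h).ne
  · exact hX p hp q hq h
  · exact absurd heq (key q hq p hp h).ne'

lemma sum_min_card_left (X : Finset Pt) (hX : ∀ x ∈ X, ∀ y ∈ X, x 0 = y 0 → x = y) (m : ℕ) :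
    ∑ p ∈ X, min m (X.filter fun x => x 0 < p 0).card = ∑ j ∈ Finset.range X.card, min m j := by
  have himg : X.image (fun p : Pt => (X.filter fun x => x 0 < p 0).card) =
      Finset.range X.card := by
    apply Finset.eq_of_subset_of_card_le
    · intro j hj
      obtain ⟨p, hp, rfl⟩ := Finset.mem_image.1 hj
      exact Finset.mem_range.2 (card_left_lt hp)
    · rw [Finset.card_image_of_injOn (injOn_card_left hX), Finset.card_range]
  rw [← himg, Finset.sum_image (injOn_card_left hX)]

lemma card_events_le {φ : Pt → ℝ} (hφ : IsSmoothGauge φ) {X : Finset Pt}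
    (hX : ∀ x ∈ X, ∀ y ∈ X, x 0 = y 0 → x = y) {m : ℕ} (E : Finset (Pt × Pt × ℝ))
    (hE : ∀ e ∈ E, e.1 ∈ X ∧ IsEvent φ X m e.1 e.2.1 e.2.2) :
    E.card ≤ ∑ j ∈ Finset.range X.card, min m j := by
  rw [← sum_min_card_left X hX, Finset.card_eq_sum_card_fiberwise (fun e he => (hE e he).1)]
  apply Finset.sum_le_sum
  intro p hp
  rw [← Finset.card_range (min m _)]
  refine Finset.card_le_card_of_injOn (fun e => (leftInside φ X e.1 e.2.1 e.2.2).card) ?_ ?_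
  · rintro ⟨q, b, σ⟩ he
    simp only [Finset.coe_filter, mem_ofPred_eq] at he
    obtain ⟨he, rfl⟩ := he
    simpa using (hE _ he).2.card_leftInside_lt
  · rintro ⟨q, b, σ⟩ he ⟨q', b', σ'⟩ he' heq
    simp only [Finset.coe_filter, mem_ofPred_eq] at he he'
    obtain ⟨he, rfl⟩ := he
    obtain ⟨he', rfl⟩ := he'
    obtain ⟨rfl, rfl⟩ := (hE _ he).2.eq_of_card_leftInside_eq hφ
      (fun x hx => hX x hx _ hp) (hE _ he').2 heq
    rfl

lemma two_mul_sum_min (m n : ℕ) (h : m < n) :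
    2 * ∑ j ∈ Finset.range n, min m j + m * (m + 1) = 2 * m * n := by
  induction n, h using Nat.le_induction with
  | base =>
    have : ∑ j ∈ Finset.range (m + 1), min m j = ∑ j ∈ Finset.range (m + 1), j :=
      Finset.sum_congr rfl fun j hj => min_eq_right (by simpa [Nat.lt_succ_iff] using hj)
    have h2 := Finset.sum_range_id_mul_two (m + 1)
    rw [this]
    simp only [Nat.add_sub_cancel] at h2
    linarith
  | succ n hn ih =>
    rw [Finset.sum_range_succ, min_eq_left (by omega)]
    linarith

/-- Points in general position with respect to the homothets of `{φ ≤ 1}`. -/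
structure GeneralPosition (φ : Pt → ℝ) (X : Finset Pt) : Prop where
  injX : ∀ x ∈ X, ∀ y ∈ X, x 0 = y 0 → x = y
  noncollinear : ∀ p ∈ X, ∀ q ∈ X, ∀ r ∈ X, p ≠ q → p ≠ r → q ≠ r →
    (q 0 - p 0) * (r 1 - p 1) - (q 1 - p 1) * (r 0 - p 0) ≠ 0
  boundary : ∀ (σ : ℝ) (w : Pt), 0 < σ → (X.filter fun x => φ (σ • x + w) = 1).card ≤ 3

/-- The reflection of a finite set in the origin. -/
def reflect (X : Finset Pt) : Finset Pt := X.map (Equiv.neg Pt).toEmbedding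

@[simp] lemma mem_reflect {X : Finset Pt} {x : Pt} : x ∈ reflect X ↔ -x ∈ X := by
  simp [reflect]

@[simp] lemma card_reflect (X : Finset Pt) : (reflect X).card = X.card := by simp [reflect]

@[simp] lemma reflect_reflect (X : Finset Pt) : reflect (reflect X) = X := by ext; simp

lemma reflect_injective : Function.Injective reflect :=
  Function.LeftInverse.injective reflect_reflect

lemma card_filter_reflect (X : Finset Pt) (P : Pt → Prop) [DecidablePred P]
    [DecidablePred fun x => P (-x)] :
    ((reflect X).filter fun x => P (-x)).card = (X.filter P).card := by
  have : (reflect X).filter (fun x => P (-x)) = reflect (X.filter P) := by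
    ext; simp
  rw [this, card_reflect]

namespace IsSmoothGauge

variable {φ : Pt → ℝ}

lemma comp_neg (hφ : IsSmoothGauge φ) : IsSmoothGauge fun x => φ (-x) where
  contDiff := hφ.contDiff.comp contDiff_neg
  strictConvex := by
    refine ⟨convex_univ, fun x _ y _ hxy a b ha hb hab => ?_⟩
    have := hφ.strictConvex.2 (mem_univ (-x)) (mem_univ (-y)) (by simpa using hxy) ha hb hab
    simpa [neg_add] using (by simpa [add_comm] using this)
  bounded := by
    obtain ⟨r, hr⟩ := hφ.bounded
    exact ⟨r, fun x hx => by simpa using hr (-x) hx⟩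
  exists_lt_one := by
    obtain ⟨z, hz⟩ := hφ.exists_lt_one
    exact ⟨-z, by simpa using hz⟩

lemma fderiv_comp_neg (hφ : IsSmoothGauge φ) (b v : Pt) :
    fderiv ℝ (fun x => φ (-x)) b v = -fderiv ℝ φ (-b) v := by
  have h := (hφ.hasFDerivAt (-b)).comp b (hasFDerivAt_id (𝕜 := ℝ) b).neg
  have e : φ ∘ Neg.neg = fun x => φ (-x) := rfl
  rw [← e, h.fderiv]
  simp

lemma isCompact_le_one (hφ : IsSmoothGauge φ) : IsCompact {x | φ x ≤ 1} := by
  obtain ⟨r, hr⟩ := hφ.bounded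
  refine Metric.isCompact_of_isClosed_isBounded
    (isClosed_le hφ.contDiff.continuous continuous_const) ?_
  exact (Metric.isBounded_closedBall (x := 0) (r := r)).subset fun x hx => by
    simpa using hr x hx

/-- In every direction there is a boundary point with that outer normal. -/
lemma exists_tangent (hφ : IsSmoothGauge φ) {g : Pt →L[ℝ] ℝ} {u : Pt} (hu : g u = 1) :
    ∃ b, φ b = 1 ∧ ∃ c > 0, ∀ v, fderiv ℝ φ b v = c * g v := by
  obtain ⟨z, hz⟩ := hφ.exists_lt_one
  obtain ⟨b, hbK, hbmax⟩ := hφ.isCompact_le_one.exists_isMaxOn ⟨z, hz.le⟩ g.continuous.continuousOn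
  have hmax : ∀ v, φ v ≤ 1 → g v ≤ g b := fun v hv => hbmax hv
  have hb : φ b = 1 := by
    refine le_antisymm hbK (not_lt.1 fun hlt => ?_)
    have hc : Continuous fun t : ℝ => φ (b + t • u) :=
      hφ.contDiff.continuous.comp (by fun_prop)
    have he : ∀ᶠ t in nhds (0 : ℝ), φ (b + t • u) < 1 :=
      hc.continuousAt.eventually (gt_mem_nhds (by simpa using hlt))
    obtain ⟨t, ht, ht0⟩ := ((he.filter_mono nhdsWithin_le_nhds).and
      (self_mem_nhdsWithin (s := Ioi (0 : ℝ)))).exists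
    have := hmax _ ht.le
    rw [map_add, map_smul, hu, smul_eq_mul] at this
    have ht0 : 0 < t := ht0
    linarith
  have hnonneg : ∀ v, 0 < g v → 0 ≤ fderiv ℝ φ b v := by
    intro v hv
    by_contra! hneg
    obtain ⟨t, ht, ht0⟩ := ((hφ.eventually_lt hneg).and
      (self_mem_nhdsWithin (s := Ioi (0 : ℝ)))).exists
    have := hmax _ (ht.le.trans hb.le)
    rw [map_add, map_smul, smul_eq_mul] at this
    have ht0 : 0 < t := ht0
    nlinarith
  have hker : ∀ v, g v = 0 → 0 ≤ fderiv ℝ φ b v := by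
    intro v hv
    refine le_of_forall_pos_le_add fun ε hε => ?_
    obtain ⟨δ, hδ, hle⟩ : ∃ δ > 0, δ * fderiv ℝ φ b u ≤ ε := by
      have h0 : 0 ≤ fderiv ℝ φ b u := hnonneg u (by simp [hu])
      refine ⟨ε / (fderiv ℝ φ b u + 1), by positivity, ?_⟩
      rw [div_mul_eq_mul_div, div_le_iff₀ (by positivity)]
      nlinarith
    have := hnonneg (v + δ • u) (by simp [hv, hu, hδ])
    rw [map_add, map_smul, smul_eq_mul] at this
    linarith
  have hall : ∀ v, fderiv ℝ φ b v = fderiv ℝ φ b u * g v := by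
    intro v
    have h1 := hker (v - g v • u) (by simp [hu])
    have h2 := hker (g v • u - v) (by simp [hu])
    rw [map_sub, map_smul, smul_eq_mul] at h1 h2
    linarith
  refine ⟨b, hb, fderiv ℝ φ b u, ?_, hall⟩
  refine lt_of_le_of_ne (hnonneg u (by simp [hu])) fun h0 => ?_
  have hzb : z ≠ b := by rintro rfl; linarith
  have := hφ.fderiv_sub_neg hzb (hz.le.trans hb.ge)
  rw [hall, ← h0, zero_mul] at this
  exact lt_irrefl _ this

end IsSmoothGauge

namespace GeneralPosition

variable {φ : Pt → ℝ} {X : Finset Pt}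

lemma reflect (h : GeneralPosition φ X) : GeneralPosition (fun x => φ (-x)) (reflect X) where
  injX x hx y hy hxy := by
    have := h.injX (-x) (mem_reflect.1 hx) (-y) (mem_reflect.1 hy) (by simp [hxy])
    simpa using this
  noncollinear p hp q hq r hr hpq hpr hqr := by
    have := h.noncollinear (-p) (mem_reflect.1 hp) (-q) (mem_reflect.1 hq) (-r) (mem_reflect.1 hr)
      (by simpa using hpq) (by simpa using hpr) (by simpa using hqr)
    contrapose! this
    simp only [PiLp.neg_apply]
    linarith
  boundary σ w hσ := by
    have := h.boundary σ (-w) hσ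
    rw [← card_filter_reflect] at this
    convert this using 4
    congr 1
    module

end GeneralPosition

/-- A homothet with at least three points of `X` on its boundary and `m - 1` in its interior. -/
structure IsTriple (φ : Pt → ℝ) (X : Finset Pt) (m : ℕ) (θ : ℝ × Pt) : Prop where
  pos : 0 < θ.1
  three : 3 ≤ (X.filter fun x => φ (θ.1 • x + θ.2) = 1).card
  card_inside : (X.filter fun x => φ (θ.1 • x + θ.2) < 1).card + 1 = m

lemma exists_ordered_three {Q : Finset Pt} (hQ : ∀ x ∈ Q, ∀ y ∈ Q, x 0 = y 0 → x = y)
    (h : 3 ≤ Q.card) : ∃ y ∈ Q, ∃ p ∈ Q, ∃ z ∈ Q, y 0 < p 0 ∧ p 0 < z 0 := by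
  obtain ⟨a, b, c, ha, hb, hc, hab, hac, hbc⟩ := Finset.two_lt_card_iff.1 h
  have hab' : a 0 ≠ b 0 := fun h => hab (hQ a ha b hb h)
  have hac' : a 0 ≠ c 0 := fun h => hac (hQ a ha c hc h)
  have hbc' : b 0 ≠ c 0 := fun h => hbc (hQ b hb c hc h)
  rcases hab'.lt_or_gt with h1 | h1 <;> rcases hac'.lt_or_gt with h2 | h2 <;>
    rcases hbc'.lt_or_gt with h3 | h3
  · exact ⟨a, ha, b, hb, c, hc, h1, h3⟩
  · exact ⟨a, ha, c, hc, b, hb, h2, h3⟩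
  · linarith
  · exact ⟨c, hc, a, ha, b, hb, h2, h1⟩
  · exact ⟨b, hb, a, ha, c, hc, h1, h2⟩
  · linarith
  · exact ⟨b, hb, c, hc, a, ha, h3, h2⟩
  · exact ⟨c, hc, b, hb, a, ha, h3, h1⟩

/-- The homothet with parameters `θ` has an event at some point. -/
def HasTie (φ : Pt → ℝ) (X : Finset Pt) (m : ℕ) (θ : ℝ × Pt) : Prop :=
  0 < θ.1 ∧ ∃ p ∈ X, IsEvent φ X m p (θ.1 • p + θ.2) θ.1

lemma level_eq_sub_one (φ : Pt → ℝ) (p x : Pt) {θ : ℝ × Pt} (h : 0 < θ.1) :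
    level φ (θ.1 • p + θ.2) θ.1 (x - p) = φ (θ.1 • x + θ.2) - 1 := by
  rw [level_of_pos _ _ _ h]
  congr 2
  module

lemma hasTie_of_lower {φ : Pt → ℝ} {X : Finset Pt} {m : ℕ} {θ : ℝ × Pt} {y p z : Pt}
    (h : IsTriple φ X m θ) (hy : y ∈ X) (hp : p ∈ X) (hz : z ∈ X)
    (hyφ : φ (θ.1 • y + θ.2) = 1) (hpφ : φ (θ.1 • p + θ.2) = 1) (hzφ : φ (θ.1 • z + θ.2) = 1)
    (hyp : y 0 < p 0) (hpz : p 0 < z 0) (hlow : fderiv ℝ φ (θ.1 • p + θ.2) yDir < 0) :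
    HasTie φ X m θ := by
  have hcard : (X.filter fun x => level φ (θ.1 • p + θ.2) θ.1 (x - p) < 0).card + 1 = m := by
    rw [← h.card_inside]
    simp only [level_eq_sub_one φ p _ h.pos, sub_neg]
  refine ⟨h.pos, p, hp, hpφ, hlow, h.pos.le, ⟨y, hy, hyp, ?_⟩, by omega,
    Or.inr ⟨⟨z, hz, hpz, ?_⟩, hcard⟩⟩
  · rw [level_eq_sub_one _ _ _ h.pos, hyφ, sub_self]
  · rw [level_eq_sub_one _ _ _ h.pos, hzφ, sub_self]

lemma IsTriple.reflect {φ : Pt → ℝ} {X : Finset Pt} {m : ℕ} {θ : ℝ × Pt}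
    (h : IsTriple φ X m θ) : IsTriple (fun x => φ (-x)) (reflect X) m (θ.1, -θ.2) where
  pos := h.pos
  three := by
    have := h.three
    rw [← card_filter_reflect] at this
    convert this using 4
    congr 1
    module
  card_inside := by
    have := h.card_inside
    rw [← card_filter_reflect] at this
    convert this using 5
    congr 1
    module

lemma IsTriple.hasTie_or {φ : Pt → ℝ} (hφ : IsSmoothGauge φ) {X : Finset Pt} {m : ℕ} {θ : ℝ × Pt}
    (hX : ∀ x ∈ X, ∀ y ∈ X, x 0 = y 0 → x = y) (h : IsTriple φ X m θ) :
    HasTie φ X m θ ∨ HasTie (fun x => φ (-x)) (_root_.reflect X) m (θ.1, -θ.2) := by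
  obtain ⟨y, hy, p, hp, z, hz, hyp, hpz⟩ := exists_ordered_three
    (fun x hx y hy => hX x (Finset.mem_filter.1 hx).1 y (Finset.mem_filter.1 hy).1) h.three
  simp only [Finset.mem_filter] at hy hp hz
  have key : ∀ x : Pt, x ≠ p → φ (θ.1 • x + θ.2) = 1 →
      fderiv ℝ φ (θ.1 • p + θ.2) (x - p) < 0 := by
    intro x hx hxφ
    refine hφ.fderiv_neg_of_le h.pos (sub_ne_zero.2 hx) ?_
    have : θ.1 • p + θ.2 + θ.1 • (x - p) = θ.1 • x + θ.2 := by module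
    rw [this, hxφ, hp.2]
  have k1 := key y (by rintro rfl; exact lt_irrefl _ hyp) hy.2
  have k2 := key z (by rintro rfl; exact lt_irrefl _ hpz) hz.2
  rw [apply_eq_coord] at k1 k2
  simp only [PiLp.sub_apply] at k1 k2
  rcases lt_trichotomy (fderiv ℝ φ (θ.1 • p + θ.2) yDir) 0 with hlt | h0 | hgt
  · exact Or.inl (hasTie_of_lower h hy.1 hp.1 hz.1 hy.2 hp.2 hz.2 hyp hpz hlt)
  · rw [h0] at k1 k2
    exfalso
    rcases le_total 0 (fderiv ℝ φ (θ.1 • p + θ.2) xDir) with hs | hs <;> nlinarith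
  · right
    have e : ∀ x : Pt, -(θ.1 • -x + -θ.2) = θ.1 • x + θ.2 := fun x => by module
    refine hasTie_of_lower h.reflect (y := -z) (p := -p) (z := -y) (by simpa using hz.1)
      (by simpa using hp.1) (by simpa using hy.1) (by simpa only [e] using hz.2)
      (by simpa only [e] using hp.2) (by simpa only [e] using hy.2) (by simpa using hpz)
      (by simpa using hyp) ?_
    rw [hφ.fderiv_comp_neg]
    simpa only [e, neg_neg_iff_pos] using hgt

/-- `H` is separated from the rest of `X` by the level lines of `α x + β y`. -/
def SeparatedBy (X H : Finset Pt) (α β : ℝ) : Prop :=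
  ∀ h ∈ H, ∀ x ∈ X, x ∉ H → α * h 0 + β * h 1 < α * x 0 + β * x 1

/-- `H` consists of a point `p` and the points strictly above a tangent halfplane event at `p`. -/
def HasExit (φ : Pt → ℝ) (X : Finset Pt) (m : ℕ) (H : Finset Pt) : Prop :=
  ∃ p ∈ X, ∃ b, IsEvent φ X m p b 0 ∧
    H = insert p (X.filter fun x => level φ b 0 (x - p) < 0)

lemma hasExit_of_separatedBy {φ : Pt → ℝ} (hφ : IsSmoothGauge φ) {X H : Finset Pt} {m : ℕ}
    (hX : GeneralPosition φ X) (hHX : H ⊆ X) (hHm : H.card ≤ m) {α β : ℝ} (hβ : β < 0)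
    (hsep : SeparatedBy X H α β) (hex : ∃ p ∈ H, ∃ x ∈ X, x ∉ H ∧ x 0 < p 0) :
    HasExit φ X m H := by
  obtain ⟨p₀, hp₀, x₀, hx₀, hx₀H, h₀⟩ := hex
  set P := (H ×ˢ (X \ H)).filter fun q => q.2 0 < q.1 0 with hP
  have hPne : P.Nonempty := ⟨(p₀, x₀), by simp [hP, hp₀, hx₀, hx₀H, h₀]⟩
  obtain ⟨⟨p, x⟩, hpx, hmin⟩ := P.exists_min_image
    (fun q => (q.1 1 - q.2 1) / (q.1 0 - q.2 0)) hPne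
  simp only [hP, Finset.mem_filter, Finset.mem_product, Finset.mem_sdiff] at hpx
  obtain ⟨⟨hp, hxX, hxH⟩, hxp⟩ := hpx
  have hpos : 0 < p 0 - x 0 := by linarith
  obtain ⟨a, ha⟩ : ∃ a, a = (p 1 - x 1) / (p 0 - x 0) := ⟨_, rfl⟩
  have ha' : p 1 - x 1 = a * (p 0 - x 0) := by rw [ha, div_mul_cancel₀ _ hpos.ne']
  have hmin' : ∀ h ∈ H, ∀ y ∈ X, y ∉ H → y 0 < h 0 → a * (h 0 - y 0) ≤ h 1 - y 1 := by
    intro h hh y hy hyH hlt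
    have := hmin (h, y) (by simp [hP, hh, hy, hyH, hlt])
    rw [← ha, le_div_iff₀ (by simpa using hlt)] at this
    exact this
  have hslope : 0 < α + β * a → False := by
    intro hc
    have := hsep p hp x hxX hxH
    nlinarith
  have hslope : α + β * a ≤ 0 := not_lt.1 hslope
  have habove : ∀ h ∈ H, a * (h 0 - p 0) ≤ h 1 - p 1 := by
    intro h hh
    by_contra! hlt
    rcases lt_or_ge (x 0) (h 0) with hc | hc
    · have := hmin' h hh x hxX hxH hc
      nlinarith
    · have h1 := hsep h hh x hxX hxH
      have h2 : h 1 - x 1 < a * (h 0 - x 0) := by linarith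
      nlinarith
  have hbelow : ∀ y ∈ X, y ∉ H → y 1 - p 1 ≤ a * (y 0 - p 0) := by
    intro y hy hyH
    by_contra! hlt
    rcases lt_or_ge (y 0) (p 0) with hc | hc
    · have := hmin' p hp y hy hyH hc
      nlinarith
    · have h1 := hsep p hp y hy hyH
      nlinarith
  obtain ⟨b, hb, c, hc, hbc⟩ := hφ.exists_tangent (u := -yDir)
    (g := a • EuclideanSpace.proj 0 - EuclideanSpace.proj 1) (by simp)
  have hlevel : ∀ v : Pt, level φ b 0 v = c * (a * v 0 - v 1) := by
    intro v
    rw [level_zero_scale, hbc]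
    simp
  have hneg : ∀ v : Pt, level φ b 0 v < 0 ↔ a * v 0 < v 1 := by
    intro v
    rw [hlevel, mul_neg_iff]
    constructor
    · rintro (h | h)
      · linarith
      · linarith
    · intro h
      exact Or.inl ⟨hc, by linarith⟩
  have hH : H = insert p (X.filter fun x => level φ b 0 (x - p) < 0) := by
    ext q
    simp only [Finset.mem_insert, Finset.mem_filter, hneg, PiLp.sub_apply]
    constructor
    · intro hq
      by_cases hqp : q = p
      · exact Or.inl hqp
      · refine Or.inr ⟨hHX hq, lt_of_le_of_ne (habove q hq) fun he => ?_⟩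
        refine hX.noncollinear p (hHX hp) x hxX q (hHX hq) ?_ (Ne.symm hqp) ?_ ?_
        · rintro rfl; exact hxH hp
        · rintro rfl; exact hxH hq
        · rw [← he]
          linear_combination (q 0 - p 0) * ha'
    · rintro (rfl | ⟨hqX, hq⟩)
      · exact hp
      · by_contra hqH
        linarith [hbelow q hqX hqH]
  have hpn : p ∉ X.filter fun x => level φ b 0 (x - p) < 0 := by
    simp [level_zero_vec hb]
  refine ⟨p, hHX hp, b, ⟨hb, ?_, le_rfl, ⟨x, hxX, hxp, ?_⟩, ?_, Or.inl rfl⟩, hH⟩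
  · rw [hbc]
    simp [hc]
  · rw [hlevel]
    simp only [PiLp.sub_apply]
    linear_combination c * ha'
  · have := congrArg Finset.card hH
    rw [Finset.card_insert_of_notMem hpn] at this
    omega

lemma eventually_separatedBy {X H : Finset Pt} {α β : ℝ} (h : SeparatedBy X H α β) :
    ∀ᶠ β' in nhds β, SeparatedBy X H α β' := by
  have : ∀ᶠ β' in nhds β, ∀ q ∈ (H ×ˢ X).filter (fun q => q.2 ∉ H),
      α * q.1 0 + β' * q.1 1 < α * q.2 0 + β' * q.2 1 := by
    rw [Finset.eventually_all]
    intro q hq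
    simp only [Finset.mem_filter, Finset.mem_product] at hq
    have h1 : Continuous fun t : ℝ => α * q.1 0 + t * q.1 1 := by fun_prop
    have h2 : Continuous fun t : ℝ => α * q.2 0 + t * q.2 1 := by fun_prop
    exact h1.continuousAt.eventually_lt h2.continuousAt (h q.1 hq.1.1 q.2 hq.1.2 hq.2)
  filter_upwards [this] with t ht a ha x hx hxH
  exact ht (a, x) (by simp [ha, hx, hxH])

lemma exists_separatedBy_gt {X H : Finset Pt} {α β : ℝ} (h : SeparatedBy X H α β) :
    ∃ β' > β, SeparatedBy X H α β' := by
  obtain ⟨t, ht, ht0⟩ := (((eventually_separatedBy h).filter_mono nhdsWithin_le_nhds).and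
    (self_mem_nhdsWithin (s := Ioi β))).exists
  exact ⟨t, ht0, ht⟩

lemma exists_separatedBy_lt {X H : Finset Pt} {α β : ℝ} (h : SeparatedBy X H α β) :
    ∃ β' < β, SeparatedBy X H α β' := by
  obtain ⟨t, ht, ht0⟩ := (((eventually_separatedBy h).filter_mono nhdsWithin_le_nhds).and
    (self_mem_nhdsWithin (s := Iio β))).exists
  exact ⟨t, ht0, ht⟩

lemma SeparatedBy.reflect {X H : Finset Pt} {α β : ℝ} (h : SeparatedBy X H α β) :
    SeparatedBy (reflect X) (reflect H) (-α) (-β) := by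
  intro a ha x hx hxH
  have := h (-a) (mem_reflect.1 ha) (-x) (mem_reflect.1 hx) (by simpa using hxH)
  simp only [PiLp.neg_apply] at this
  linarith

lemma hasExit_or {φ : Pt → ℝ} (hφ : IsSmoothGauge φ) {X H : Finset Pt} {m : ℕ}
    (hX : GeneralPosition φ X) (hHX : H ⊆ X) (hHne : H.Nonempty) (hHm : H.card ≤ m)
    (hm : m < X.card) (hsep : ∃ α β, SeparatedBy X H α β) :
    HasExit φ X m H ∨ HasExit (fun x => φ (-x)) (reflect X) m (reflect H) := by
  have hup : ∀ {α β : ℝ}, β < 0 → SeparatedBy X H α β →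
      (∃ p ∈ H, ∃ x ∈ X, x ∉ H ∧ x 0 < p 0) → HasExit φ X m H := fun hβ hs hex =>
    hasExit_of_separatedBy hφ hX hHX hHm hβ hs hex
  have hdown : ∀ {α β : ℝ}, 0 < β → SeparatedBy X H α β →
      (∃ p ∈ H, ∃ x ∈ X, x ∉ H ∧ p 0 < x 0) →
      HasExit (fun x => φ (-x)) (reflect X) m (reflect H) := by
    rintro α β hβ hs ⟨p, hp, x, hx, hxH, hlt⟩
    refine hasExit_of_separatedBy hφ.comp_neg hX.reflect ?_ (by simpa using hHm)
      (neg_neg_of_pos hβ) hs.reflect ⟨-p, by simpa using hp, -x, by simpa using hx,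
        by simpa using hxH, by simpa using hlt⟩
    intro y hy
    rw [mem_reflect] at hy ⊢
    exact hHX hy
  obtain ⟨x₁, hx₁, hx₁H⟩ : ∃ x ∈ X, x ∉ H := by
    by_contra! hc
    have := Finset.card_le_card (show X ⊆ H from hc)
    omega
  obtain ⟨p₁, hp₁⟩ := hHne
  by_cases hinit : ∃ p ∈ H, ∃ x ∈ X, x ∉ H ∧ x 0 < p 0
  · by_cases hfin : ∃ p ∈ H, ∃ x ∈ X, x ∉ H ∧ p 0 < x 0
    · obtain ⟨α, β, hs⟩ := hsep
      rcases lt_trichotomy β 0 with hlt | rfl | hgt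
      · exact Or.inl (hup hlt hs hinit)
      · obtain ⟨β', hβ', hs'⟩ := exists_separatedBy_lt hs
        exact Or.inl (hup hβ' hs' hinit)
      · exact Or.inr (hdown hgt hs hfin)
    · push Not at hfin
      have hs : SeparatedBy X H (-1) 0 := by
        intro h hh x hx hxH
        have h1 := hfin h hh x hx hxH
        have h2 : x 0 ≠ h 0 := fun he => hxH (hX.injX x hx h (hHX hh) he ▸ hh)
        have := lt_of_le_of_ne h1 h2
        linarith
      obtain ⟨β', hβ', hs'⟩ := exists_separatedBy_lt hs
      exact Or.inl (hup hβ' hs' hinit)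
  · push Not at hinit
    have hlt : ∀ h ∈ H, ∀ x ∈ X, x ∉ H → h 0 < x 0 := by
      intro h hh x hx hxH
      have h1 := hinit h hh x hx hxH
      have h2 : h 0 ≠ x 0 := fun he => hxH (hX.injX h (hHX hh) x hx he ▸ hh)
      exact lt_of_le_of_ne h1 h2
    have hs : SeparatedBy X H 1 0 := by
      intro h hh x hx hxH
      linarith [hlt h hh x hx hxH]
    obtain ⟨β', hβ', hs'⟩ := exists_separatedBy_gt hs
    exact Or.inr (hdown hβ' hs' ⟨p₁, hp₁, x₁, hx₁, hx₁H, hlt p₁ hp₁ x₁ hx₁ hx₁H⟩)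

lemma card_add_card_le_of_events {φ : Pt → ℝ} (hφ : IsSmoothGauge φ) {X : Finset Pt} {m : ℕ}
    (hX : ∀ x ∈ X, ∀ y ∈ X, x 0 = y 0 → x = y) {Θ : Finset (ℝ × Pt)} {𝓗 : Finset (Finset Pt)}
    (hΘ : ∀ θ ∈ Θ, HasTie φ X m θ) (h𝓗 : ∀ H ∈ 𝓗, HasExit φ X m H) :
    Θ.card + 𝓗.card ≤ ∑ j ∈ Finset.range X.card, min m j := by
  classical
  choose! hpos p hpX hp using hΘ
  choose! q hqX b hb hH using h𝓗
  have i1 : Set.InjOn (fun θ : ℝ × Pt => (p θ, θ.1 • p θ + θ.2, θ.1)) Θ := by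
    intro θ hθ θ' hθ' he
    simp only [Prod.mk.injEq] at he
    obtain ⟨e1, e2, e3⟩ := he
    rw [e1, e3] at e2
    exact Prod.ext e3 (add_left_cancel e2)
  have i2 : Set.InjOn (fun H : Finset Pt => (q H, b H, (0 : ℝ))) 𝓗 := by
    intro H hH' H₂ hH₂ he
    simp only [Prod.mk.injEq] at he
    rw [hH H hH', hH H₂ hH₂, he.1, he.2.1]
  rw [← Finset.card_image_of_injOn i1, ← Finset.card_image_of_injOn i2,
    ← Finset.card_union_of_disjoint]
  · refine card_events_le hφ hX _ fun e he => ?_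
    rcases Finset.mem_union.1 he with he | he
    · obtain ⟨θ, hθ, rfl⟩ := Finset.mem_image.1 he
      exact ⟨hpX θ hθ, hp θ hθ⟩
    · obtain ⟨H, hH', rfl⟩ := Finset.mem_image.1 he
      exact ⟨hqX H hH', hb H hH'⟩
  · rw [Finset.disjoint_left]
    intro e he he'
    obtain ⟨θ, hθ, rfl⟩ := Finset.mem_image.1 he
    obtain ⟨H, hH', he'⟩ := Finset.mem_image.1 he'
    simp only [Prod.mk.injEq] at he'
    exact (hpos θ hθ).ne he'.2.2

/-- Triples and halving sets together are bounded by twice the number of possible events. -/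
lemma card_triples_add_card_separated_le {φ : Pt → ℝ} (hφ : IsSmoothGauge φ) {X : Finset Pt}
    {m : ℕ} (hX : GeneralPosition φ X) (hm : m < X.card)
    {Θ : Finset (ℝ × Pt)} {𝓗 : Finset (Finset Pt)} (hΘ : ∀ θ ∈ Θ, IsTriple φ X m θ)
    (h𝓗 : ∀ H ∈ 𝓗, H ⊆ X ∧ H.Nonempty ∧ H.card ≤ m ∧ ∃ α β, SeparatedBy X H α β) :
    Θ.card + 𝓗.card ≤ 2 * ∑ j ∈ Finset.range X.card, min m j := by
  classical
  have hup := card_add_card_le_of_events hφ hX.injX (Θ := Θ.filter (HasTie φ X m))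
    (𝓗 := 𝓗.filter (HasExit φ X m)) (fun θ hθ => (Finset.mem_filter.1 hθ).2)
    (fun H hH => (Finset.mem_filter.1 hH).2)
  have hdown := card_add_card_le_of_events hφ.comp_neg hX.reflect.injX
    (Θ := (Θ.filter fun θ => ¬ HasTie φ X m θ).image fun θ => (θ.1, -θ.2))
    (𝓗 := (𝓗.filter fun H => ¬ HasExit φ X m H).image reflect) (m := m)
    (by
      intro θ hθ
      obtain ⟨θ, hθ', rfl⟩ := Finset.mem_image.1 hθ
      rw [Finset.mem_filter] at hθ'
      exact ((hΘ θ hθ'.1).hasTie_or hφ hX.injX).resolve_left hθ'.2)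
    (by
      intro H hH
      obtain ⟨H, hH', rfl⟩ := Finset.mem_image.1 hH
      rw [Finset.mem_filter] at hH'
      obtain ⟨h1, h2, h3, h4⟩ := h𝓗 H hH'.1
      exact (hasExit_or hφ hX h1 h2 h3 hm h4).resolve_left hH'.2)
  rw [Finset.card_image_of_injective _ reflect_injective, Finset.card_image_of_injective _ ?_,
    card_reflect] at hdown
  · have e1 := Finset.card_filter_add_card_filter_not (s := Θ) (HasTie φ X m)
    have e2 := Finset.card_filter_add_card_filter_not (s := 𝓗) (HasExit φ X m)
    omega
  · intro θ θ' he
    simp only [Prod.mk.injEq, neg_inj] at he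
    exact Prod.ext he.1 he.2

/-- Gordan's alternative in three dimensions. -/
lemma exists_pos_or_exists_relation {ι : Type*} (V : Finset ι) (g : ι → ℝ × ℝ × ℝ) :
    (∃ s a b : ℝ, ∀ v ∈ V, 0 < s * (g v).1 + a * (g v).2.1 + b * (g v).2.2) ∨
      ∃ l : ι → ℝ, (∀ v ∈ V, 0 ≤ l v) ∧ (∑ v ∈ V, l v = 1) ∧ ∑ v ∈ V, l v • g v = 0 := by
  classical
  by_cases h : (0 : ℝ × ℝ × ℝ) ∈ (fun l : V → ℝ => ∑ v, l v • g v) '' stdSimplex ℝ V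
  · right
    obtain ⟨l, hl, hl0⟩ := h
    refine ⟨fun v => if hv : v ∈ V then l ⟨v, hv⟩ else 0, fun v hv => ?_, ?_, ?_⟩
    · simpa [hv] using hl.1 ⟨v, hv⟩
    · rw [← hl.2, ← Finset.sum_coe_sort V]
      exact Finset.sum_congr rfl fun v _ => by simp
    · rw [← hl0, ← Finset.sum_coe_sort V]
      exact Finset.sum_congr rfl fun v _ => by simp
  · left
    have hlin : IsLinearMap ℝ fun l : V → ℝ => ∑ v, l v • g v :=
      { map_add := fun a b => by simp [add_smul, Finset.sum_add_distrib]
        map_smul := fun c a => by simp [Finset.smul_sum, mul_smul] }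
    have hcomp : IsCompact ((fun l : V → ℝ => ∑ v, l v • g v) '' stdSimplex ℝ V) :=
      (isCompact_stdSimplex ℝ V).image (by fun_prop)
    obtain ⟨f, u, hf0, hf⟩ := geometric_hahn_banach_point_closed
      ((convex_stdSimplex ℝ V).is_linear_image hlin) hcomp.isClosed h
    rw [map_zero] at hf0
    refine ⟨f (1, 0, 0), f (0, 1, 0), f (0, 0, 1), fun v hv => ?_⟩
    have h1 := hf (g v) ⟨Pi.single ⟨v, hv⟩ 1, single_mem_stdSimplex ℝ _, by
      simp only
      rw [Finset.sum_eq_single ⟨v, hv⟩] <;> simp +contextual⟩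
    have h2 : g v = (g v).1 • ((1, 0, 0) : ℝ × ℝ × ℝ) + (g v).2.1 • ((0, 1, 0) : ℝ × ℝ × ℝ) +
        (g v).2.2 • ((0, 0, 1) : ℝ × ℝ × ℝ) := by simp
    have h3 : f (g v) = f (1, 0, 0) * (g v).1 + f (0, 1, 0) * (g v).2.1 +
        f (0, 0, 1) * (g v).2.2 := by
      conv_lhs => rw [h2]
      simp only [map_add, map_smul, smul_eq_mul]
      ring
    rw [← h3]
    linarith

/-- The values `φ v` for `v ∈ V` change to first order by linearly dependent amounts under
infinitesimal homotheties, with coefficients `ρ`. -/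
def IsRelation (φ : Pt → ℝ) (V : Finset Pt) (ρ : Pt → ℝ) : Prop :=
  ∀ (s : ℝ) (d : Pt), ∑ v ∈ V, ρ v * fderiv ℝ φ v (s • v + d) = 0

namespace IsRelation

variable {φ : Pt → ℝ} {V : Finset Pt} {ρ ρ' : Pt → ℝ}

lemma neg (h : IsRelation φ V ρ) : IsRelation φ V (-ρ) := by
  intro s d
  simpa using h s d

lemma eq_zero_of_card_pos_le_one (hφ : IsSmoothGauge φ) (hV : ∀ v ∈ V, φ v = 1)
    (h : IsRelation φ V ρ) (hcard : (V.filter fun v => 0 < ρ v).card ≤ 1) :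
    ∀ v ∈ V, ρ v = 0 := by
  obtain ⟨z, hz⟩ := hφ.exists_lt_one
  have hpos : ∀ v ∈ V, ∀ u, u ≠ v → φ u ≤ 1 → 0 < fderiv ℝ φ v ((1 : ℝ) • v + -u) := by
    intro v hv u hu hu1
    have := hφ.fderiv_sub_neg hu (hu1.trans (hV v hv).ge)
    rw [map_sub] at this
    rw [map_add, map_smul, map_neg, one_smul]
    linarith
  obtain ⟨u, hu1, hu, huV⟩ : ∃ u, φ u ≤ 1 ∧ (∀ v ∈ V, 0 < ρ v → v = u) ∧ (u ∈ V → 0 < ρ u) := by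
    rcases Finset.card_le_one_iff_subset_singleton.1 hcard with ⟨u, hu⟩
    have hu' : ∀ v ∈ V, 0 < ρ v → v = u := fun v hv hv0 => by
      simpa using hu (Finset.mem_filter.2 ⟨hv, hv0⟩)
    by_cases hmem : u ∈ V ∧ 0 < ρ u
    · exact ⟨u, (hV u hmem.1).le, hu', fun _ => hmem.2⟩
    · refine ⟨z, hz.le, fun v hv hv0 => absurd ?_ hmem, fun hzV => ?_⟩
      · rw [← hu' v hv hv0]
        exact ⟨hv, hv0⟩
      · linarith [hV z hzV]
  have hnn : ∀ v ∈ V, 0 ≤ ρ v := by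
    have hle : ∀ v ∈ V, ρ v * fderiv ℝ φ v ((1 : ℝ) • v + -u) ≤ 0 := by
      intro v hv
      by_cases hvu : u = v
      · simp [hvu]
      · have : ρ v ≤ 0 := not_lt.1 fun h0 => hvu (hu v hv h0).symm
        exact mul_nonpos_of_nonpos_of_nonneg this (hpos v hv u hvu hu1).le
    have hz := (Finset.sum_eq_zero_iff_of_nonpos hle).1 (h 1 (-u))
    intro v hv
    by_contra! hneg
    rcases mul_eq_zero.1 (hz v hv) with h0 | h0
    · exact hneg.ne h0
    · by_cases hvu : u = v
      · exact lt_asymm hneg (hvu ▸ huV (hvu ▸ hv))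
      · exact (hpos v hv u hvu hu1).ne' h0
  have hge : ∀ v ∈ V, 0 ≤ ρ v * fderiv ℝ φ v ((1 : ℝ) • v + -z) := fun v hv =>
    mul_nonneg (hnn v hv) (hpos v hv z (by rintro rfl; linarith [hV z hv]) hz.le).le
  intro v hv
  rcases mul_eq_zero.1 ((Finset.sum_eq_zero_iff_of_nonneg hge).1 (h 1 (-z)) v hv) with h0 | h0
  · exact h0
  · exact absurd h0 (hpos v hv z (by rintro rfl; linarith [hV z hv]) hz.le).ne'

lemma two_le_card_pos (hφ : IsSmoothGauge φ) (hV : ∀ v ∈ V, φ v = 1)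
    (h : IsRelation φ V ρ) (hne : ∃ v ∈ V, ρ v ≠ 0) : 2 ≤ (V.filter fun v => 0 < ρ v).card := by
  by_contra! hc
  obtain ⟨v, hv, hv0⟩ := hne
  exact hv0 (h.eq_zero_of_card_pos_le_one hφ hV (by omega) v hv)

lemma two_le_card_neg (hφ : IsSmoothGauge φ) (hV : ∀ v ∈ V, φ v = 1)
    (h : IsRelation φ V ρ) (hne : ∃ v ∈ V, ρ v ≠ 0) : 2 ≤ (V.filter fun v => ρ v < 0).card := by
  simpa using h.neg.two_le_card_pos hφ hV (by simpa using hne)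

lemma card_pos_add_card_neg_le (V : Finset Pt) (ρ : Pt → ℝ) :
    (V.filter fun v => 0 < ρ v).card + (V.filter fun v => ρ v < 0).card ≤ V.card := by
  classical
  rw [← Finset.card_union_of_disjoint]
  · exact Finset.card_le_card
      (Finset.union_subset (Finset.filter_subset _ _) (Finset.filter_subset _ _))
  · rw [Finset.disjoint_filter]
    intro v _ h1 h2
    exact lt_asymm h1 h2

lemma eq_zero_of_card_le_three (hφ : IsSmoothGauge φ) (hV : ∀ v ∈ V, φ v = 1)
    (h : IsRelation φ V ρ) (hcard : V.card ≤ 3) : ∀ v ∈ V, ρ v = 0 := by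
  by_contra! hne
  have h1 := h.two_le_card_pos hφ hV hne
  have h2 := h.two_le_card_neg hφ hV hne
  have h3 := card_pos_add_card_neg_le V ρ
  omega

/-- Relations on four points that are positive at a common point have the same signs. -/
lemma neg_of_neg (hφ : IsSmoothGauge φ) {β : Pt} (hV : ∀ v ∈ insert β V, φ v = 1) (hβ : β ∉ V)
    (hcard : V.card ≤ 3) (h : IsRelation φ (insert β V) ρ) (h' : IsRelation φ (insert β V) ρ')
    (hβρ : 0 < ρ β) (hβρ' : 0 < ρ' β) {v : Pt} (hv : v ∈ V) (hneg : ρ v < 0) : ρ' v < 0 := by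
  have hrel : IsRelation φ V fun v => ρ β * ρ' v - ρ' β * ρ v := by
    intro s d
    have e1 := h s d
    have e2 := h' s d
    rw [Finset.sum_insert hβ] at e1 e2
    simp only [sub_mul, mul_assoc, Finset.sum_sub_distrib, ← Finset.mul_sum]
    linear_combination ρ β * e2 - ρ' β * e1
  have := hrel.eq_zero_of_card_le_three hφ (fun v hv => hV v (Finset.mem_insert_of_mem hv)) hcard
    v hv
  have h1 : ρ' β * ρ v < 0 := mul_neg_of_pos_of_neg hβρ' hneg
  have h2 : ρ β * ρ' v < 0 := by linarith
  exact neg_of_mul_neg_right h2 hβρ.le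

end IsRelation

/-- `Y` is captured by the homothet with parameters `σ, w` up to boundary points. -/
structure WeakCapture (φ : Pt → ℝ) (X Y : Finset Pt) (σ : ℝ) (w : Pt) : Prop where
  pos : 0 < σ
  le_one : ∀ y ∈ Y, φ (σ • y + w) ≤ 1
  one_le : ∀ x ∈ X, x ∉ Y → 1 ≤ φ (σ • x + w)

/-- `β` is the rightmost point of `{φ ≤ 1}`. -/
def IsRightmost (φ : Pt → ℝ) (β : Pt) : Prop :=
  φ β = 1 ∧ ∃ c > 0, ∀ v, fderiv ℝ φ β v = c * v 0

namespace IsRightmost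

variable {φ : Pt → ℝ} {β : Pt}

lemma exists_of_gauge (hφ : IsSmoothGauge φ) : ∃ β, IsRightmost φ β := by
  obtain ⟨b, hb, c, hc, h⟩ := hφ.exists_tangent (u := xDir) (g := EuclideanSpace.proj 0) (by simp)
  exact ⟨b, hb, c, hc, fun v => by simpa using h v⟩

lemma lt (hφ : IsSmoothGauge φ) (hβ : IsRightmost φ β) {u : Pt} (hu : φ u ≤ 1) (hne : u ≠ β) :
    u 0 < β 0 := by
  obtain ⟨hβ1, c, hc, hβc⟩ := hβ
  have := hφ.fderiv_sub_neg hne (hu.trans hβ1.ge)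
  rw [hβc, PiLp.sub_apply] at this
  have := neg_of_mul_neg_right this hc.le
  linarith

lemma le (hφ : IsSmoothGauge φ) (hβ : IsRightmost φ β) {u : Pt} (hu : φ u ≤ 1) : u 0 ≤ β 0 := by
  by_cases h : u = β
  · rw [h]
  · exact (hβ.lt hφ hu h).le

end IsRightmost

lemma fderiv_sub_neg_of_weakCapture {φ : Pt → ℝ} (hφ : IsSmoothGauge φ) {X Y : Finset Pt}
    {σ : ℝ} {w x y : Pt} (h : WeakCapture φ X Y σ w) (hx : x ∈ X) (hxY : x ∉ Y) (hy : y ∈ Y) :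
    fderiv ℝ φ (σ • x + w) (y - x) < 0 := by
  refine hφ.fderiv_neg_of_le h.pos (sub_ne_zero.2 ?_) ?_
  · rintro rfl; exact hxY hy
  · have e : σ • x + w + σ • (y - x) = σ • y + w := by module
    rw [e]
    exact (h.le_one y hy).trans (h.one_le x hx hxY)

/-- Unless `Y` is an initial segment of `X` from the left, there is a weak capture of `Y` that
extends least to the right. -/
lemma exists_min_extent {φ : Pt → ℝ} (hφ : IsSmoothGauge φ) {β : Pt} (hβ : IsRightmost φ β)
    {X Y : Finset Pt} {σ₁ : ℝ} {w₁ : Pt} (h₁ : WeakCapture φ X Y σ₁ w₁)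
    (hY : 2 ≤ Y.card) (hinit : ∃ y ∈ Y, ∃ x ∈ X, x ∉ Y ∧ x 0 < y 0) :
    ∃ σ w, WeakCapture φ X Y σ w ∧ ∀ σ' w', WeakCapture φ X Y σ' w' →
      (β 0 - w 0) / σ ≤ (β 0 - w' 0) / σ' := by
  obtain ⟨y, hy, x, hx, hxY, hxy⟩ := hinit
  set E := (β 0 - w₁ 0) / σ₁ with hE
  have hφc := hφ.contDiff.continuous
  have hdc : Continuous (fderiv ℝ φ) := hφ.contDiff.continuous_fderiv (by norm_num)
  set C : Set (ℝ × Pt) := {θ | 0 ≤ θ.1 ∧ (∀ u ∈ Y, φ (θ.1 • u + θ.2) ≤ 1) ∧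
    (∀ u ∈ X, u ∉ Y → 1 ≤ φ (θ.1 • u + θ.2)) ∧ β 0 - θ.2 0 ≤ θ.1 * E ∧
    fderiv ℝ φ (θ.1 • x + θ.2) (y - x) ≤ 0} with hC
  have hmemC : ∀ σ w, WeakCapture φ X Y σ w → (β 0 - w 0) / σ ≤ E → (σ, w) ∈ C := by
    intro σ w h hle
    refine ⟨h.pos.le, h.le_one, h.one_le, ?_,
      (fderiv_sub_neg_of_weakCapture hφ h hx hxY hy).le⟩
    rw [div_le_iff₀ h.pos] at hle
    simp only
    linarith
  have hpos : ∀ θ ∈ C, 0 < θ.1 := by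
    rintro ⟨σ, w⟩ ⟨h0, hle, -, hext, hd⟩
    refine lt_of_le_of_ne h0 fun h => ?_
    simp only at h hle hext hd
    subst h
    simp only [zero_smul, zero_add, zero_mul] at hle hext hd
    have hw : w = β := by
      by_contra hne
      have := hβ.lt hφ (hle y hy) hne
      linarith
    obtain ⟨-, c, hc, hβc⟩ := hβ
    rw [hw, hβc, PiLp.sub_apply] at hd
    have : 0 < c * (y 0 - x 0) := mul_pos hc (by linarith)
    linarith
  have hclosed : IsClosed C := by
    have c1 : ∀ u : Pt, Continuous fun θ : ℝ × Pt => φ (θ.1 • u + θ.2) := fun u =>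
      hφc.comp (by fun_prop)
    have c2 : Continuous fun θ : ℝ × Pt => fderiv ℝ φ (θ.1 • x + θ.2) (y - x) :=
      (hdc.comp (by fun_prop : Continuous fun θ : ℝ × Pt => θ.1 • x + θ.2)).clm_apply
        continuous_const
    have c3 : Continuous fun θ : ℝ × Pt => β 0 - θ.2 0 := by fun_prop
    simp only [hC, ofPred_and, ofPred_forall]
    refine (isClosed_le continuous_const continuous_fst).inter ((isClosed_biInter fun u _ =>
      isClosed_le (c1 u) continuous_const).inter ((isClosed_biInter fun u _ =>
      isClosed_iInter fun _ => isClosed_le continuous_const (c1 u)).inter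
      ((isClosed_le c3 (by fun_prop)).inter (isClosed_le c2 continuous_const))))
  have hbdd : Bornology.IsBounded C := by
    obtain ⟨r, hr⟩ := hφ.bounded
    obtain ⟨a, ha, b, hb, hab⟩ := Finset.one_lt_card.1 (show 1 < Y.card by omega)
    have hab0 : 0 < ‖a - b‖ := norm_pos_iff.2 (sub_ne_zero.2 hab)
    have hsig : ∀ θ ∈ C, ‖θ.1‖ ≤ 2 * r / ‖a - b‖ := by
      intro θ hθ
      rw [le_div_iff₀ hab0, ← norm_smul]
      have e : θ.1 • (a - b) = (θ.1 • a + θ.2) - (θ.1 • b + θ.2) := by module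
      rw [e]
      have := norm_sub_le (θ.1 • a + θ.2) (θ.1 • b + θ.2)
      have h1 := hr _ (hθ.2.1 a ha)
      have h2 := hr _ (hθ.2.1 b hb)
      linarith
    rw [isBounded_iff_forall_norm_le]
    refine ⟨max (2 * r / ‖a - b‖) (r + 2 * r / ‖a - b‖ * ‖a‖), fun θ hθ => ?_⟩
    rw [Prod.norm_def]
    refine max_le_max (hsig θ hθ) ?_
    have e : θ.2 = (θ.1 • a + θ.2) - θ.1 • a := by module
    rw [e]
    refine (norm_sub_le _ _).trans (add_le_add (hr _ (hθ.2.1 a ha)) ?_)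
    rw [norm_smul]
    exact mul_le_mul_of_nonneg_right (hsig θ hθ) (norm_nonneg _)
  have hcomp := Metric.isCompact_of_isClosed_isBounded hclosed hbdd
  have hcont : ContinuousOn (fun θ : ℝ × Pt => (β 0 - θ.2 0) / θ.1) C :=
    ContinuousOn.div (by fun_prop) (by fun_prop) fun θ hθ => (hpos θ hθ).ne'
  obtain ⟨⟨σ, w⟩, hmem, hmin⟩ := hcomp.exists_isMinOn ⟨_, hmemC σ₁ w₁ h₁ le_rfl⟩ hcont
  refine ⟨σ, w, ⟨hpos _ hmem, hmem.2.1, hmem.2.2.1⟩, fun σ' w' h' => ?_⟩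
  rcases le_total ((β 0 - w' 0) / σ') E with hle | hle
  · exact hmin (hmemC σ' w' h' hle)
  · exact le_trans (hmin (hmemC σ₁ w₁ h₁ le_rfl)) hle

/-- Weak capture of `Y` by the homothet whose rightmost point is `y ∈ Y`. -/
def IsApex (φ : Pt → ℝ) (β : Pt) (X Y : Finset Pt) (y : Pt) (σ : ℝ) : Prop :=
  y ∈ Y ∧ WeakCapture φ X Y σ (β - σ • y)

/-- The data attached to a weak capture of `Y` extending least to the right: the homothet is a
triple without a point of `X` at its rightmost point, and `Y` can be read off from the signs of
the relation among the boundary points. -/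
structure IsExtremal (φ : Pt → ℝ) (β : Pt) (X : Finset Pt) (m : ℕ) (Y : Finset Pt) (θ : ℝ × Pt) :
    Prop where
  capture : WeakCapture φ X Y θ.1 θ.2
  triple : IsTriple φ X m θ
  ne_rightmost : ∀ x ∈ X, θ.1 • x + θ.2 ≠ β
  exists_relation : ∃ ρ : Pt → ℝ, 0 < ρ β ∧
    IsRelation φ (insert β ((X.filter fun x => φ (θ.1 • x + θ.2) = 1).image
      fun x => θ.1 • x + θ.2)) ρ ∧
    ∀ x ∈ X, φ (θ.1 • x + θ.2) = 1 → (x ∈ Y ↔ ρ (θ.1 • x + θ.2) < 0)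

lemma homothety_injective {σ : ℝ} (hσ : 0 < σ) (w : Pt) :
    Function.Injective fun x : Pt => σ • x + w := by
  intro x y h
  simpa [hσ.ne'] using h

lemma IsSmoothGauge.eventually_gt {φ : Pt → ℝ} (hφ : IsSmoothGauge φ) {b w : Pt}
    (h : 0 < fderiv ℝ φ b w) : ∀ t : ℝ, 0 < t → φ b < φ (b + t • w) := by
  intro t ht
  by_contra! hle
  have hw : w ≠ 0 := by rintro rfl; simp at h
  exact lt_asymm h (hφ.fderiv_neg_of_le ht hw hle)

/-- At a minimal weak capture no infinitesimal homothety improves all tight constraints. -/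
lemma not_exists_improving {φ : Pt → ℝ} (hφ : IsSmoothGauge φ) {β : Pt} (hβ : IsRightmost φ β)
    {X Y : Finset Pt} {σ : ℝ} {w : Pt} (h : WeakCapture φ X Y σ w)
    (hmin : ∀ σ' w', WeakCapture φ X Y σ' w' → (β 0 - w 0) / σ ≤ (β 0 - w' 0) / σ')
    (s : ℝ) (d : Pt) (hdβ : 0 < fderiv ℝ φ β (s • β + d))
    (hdY : ∀ x ∈ Y, φ (σ • x + w) = 1 →
      fderiv ℝ φ (σ • x + w) (s • (σ • x + w) + d) < 0)
    (hdX : ∀ x ∈ X, x ∉ Y → φ (σ • x + w) = 1 →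
      0 < fderiv ℝ φ (σ • x + w) (s • (σ • x + w) + d)) : False := by
  have hφc := hφ.contDiff.continuous
  have hcont : ∀ b : Pt, Filter.Tendsto (fun t : ℝ => φ (b + t • (s • b + d)))
      (nhdsWithin 0 (Ioi 0)) (nhds (φ b)) := by
    intro b
    have : Continuous fun t : ℝ => φ (b + t • (s • b + d)) := hφc.comp (by fun_prop)
    have := this.tendsto 0
    simp only [zero_smul, add_zero] at this
    exact this.mono_left nhdsWithin_le_nhds
  have e1 : ∀ᶠ t in nhdsWithin (0 : ℝ) (Ioi 0), ∀ x ∈ Y,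
      φ (σ • x + w + t • (s • (σ • x + w) + d)) ≤ 1 := by
    rw [Finset.eventually_all]
    intro x hx
    rcases (h.le_one x hx).lt_or_eq with hlt | heq
    · exact ((hcont _).eventually (gt_mem_nhds hlt)).mono fun _ h => le_of_lt h
    · have := hφ.eventually_lt (hdY x hx heq)
      rw [heq] at this
      exact this.mono fun _ h => h.le
  have e2 : ∀ᶠ t in nhdsWithin (0 : ℝ) (Ioi 0), ∀ x ∈ X, x ∉ Y →
      1 ≤ φ (σ • x + w + t • (s • (σ • x + w) + d)) := by
    rw [Finset.eventually_all]
    intro x hx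
    by_cases hxY : x ∈ Y
    · simp [hxY]
    rcases (h.one_le x hx hxY).lt_or_eq with hlt | heq
    · exact ((hcont _).eventually (lt_mem_nhds hlt)).mono fun _ h _ => le_of_lt h
    · filter_upwards [self_mem_nhdsWithin] with t ht _
      have := hφ.eventually_gt (hdX x hx hxY heq.symm) t ht
      rw [← heq] at this
      exact this.le
  have e3 : ∀ᶠ t in nhdsWithin (0 : ℝ) (Ioi 0), 0 < 1 + t * s := by
    have : Continuous fun t : ℝ => 1 + t * s := by fun_prop
    have := this.tendsto 0
    simp only [zero_mul, add_zero] at this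
    exact (this.mono_left nhdsWithin_le_nhds).eventually (lt_mem_nhds one_pos)
  obtain ⟨t, ht1, ht2, ht3, ht0⟩ := (e1.and (e2.and (e3.and self_mem_nhdsWithin))).exists
  have ht0 : 0 < t := ht0
  have e : ∀ x : Pt, ((1 + t * s) * σ) • x + ((1 + t * s) • w + t • d) =
      σ • x + w + t • (s • (σ • x + w) + d) := fun x => by module
  have hnew : WeakCapture φ X Y ((1 + t * s) * σ) ((1 + t * s) • w + t • d) :=
    ⟨mul_pos ht3 h.pos, fun x hx => by rw [e]; exact ht1 x hx,
      fun x hx hxY => by rw [e]; exact ht2 x hx hxY⟩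
  have hle := hmin _ _ hnew
  rw [div_le_div_iff₀ h.pos hnew.pos] at hle
  simp only [PiLp.add_apply, PiLp.smul_apply, smul_eq_mul] at hle
  obtain ⟨-, c, hc, hβc⟩ := hβ
  rw [hβc] at hdβ
  simp only [PiLp.add_apply, PiLp.smul_apply, smul_eq_mul] at hdβ
  have hp : 0 < s * β 0 + d 0 := pos_of_mul_pos_right hdβ hc.le
  have hp' : 0 < t * (s * β 0 + d 0) * σ := by have := h.pos; positivity
  nlinarith

lemma isExtremal_of_min {φ : Pt → ℝ} (hφ : IsSmoothGauge φ) {β : Pt} (hβ : IsRightmost φ β)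
    {X Y : Finset Pt} (hX : GeneralPosition φ X) {m : ℕ} (hYX : Y ⊆ X) (hYm : Y.card = m + 1)
    {σ : ℝ} {w : Pt} (h : WeakCapture φ X Y σ w)
    (hmin : ∀ σ' w', WeakCapture φ X Y σ' w' → (β 0 - w 0) / σ ≤ (β 0 - w' 0) / σ')
    (hne : ∀ y ∈ Y, σ • y + w ≠ β) : IsExtremal φ β X m Y (σ, w) := by
  classical
  have hinj := homothety_injective h.pos w
  set Q := X.filter fun x => φ (σ • x + w) = 1 with hQ
  set V := insert β (Q.image fun x => σ • x + w) with hV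
  have hV1 : ∀ v ∈ V, φ v = 1 := by
    intro v hv
    rcases Finset.mem_insert.1 hv with rfl | hv
    · exact hβ.1
    · obtain ⟨x, hx, rfl⟩ := Finset.mem_image.1 hv
      exact (Finset.mem_filter.1 hx).2
  set ε : Pt → ℝ := fun v => if v ∈ Y.image fun x => σ • x + w then -1 else 1 with hε
  have hεY : ∀ x ∈ Y, ε (σ • x + w) = -1 := fun x hx => by
    simp only [hε]
    rw [if_pos (Finset.mem_image_of_mem (fun x => σ • x + w) hx)]
  have hεX : ∀ x, x ∉ Y → ε (σ • x + w) = 1 := fun x hx => by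
    simp only [hε]
    rw [if_neg]
    rintro hmem
    obtain ⟨y, hy, he⟩ := Finset.mem_image.1 hmem
    exact hx (hinj he ▸ hy)
  have hβY : β ∉ Y.image fun x => σ • x + w := by
    intro hmem
    obtain ⟨y, hy, he⟩ := Finset.mem_image.1 hmem
    exact hne y hy he
  have hεβ : ε β = 1 := by simp only [hε]; rw [if_neg hβY]
  rcases exists_pos_or_exists_relation V fun v =>
    (ε v * fderiv ℝ φ v v, ε v * fderiv ℝ φ v xDir, ε v * fderiv ℝ φ v yDir) with
    ⟨s, a, b, hpos⟩ | ⟨l, hl0, hl1, hl⟩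
  · exfalso
    have hpos' : ∀ v ∈ V, 0 < ε v * fderiv ℝ φ v (s • v + (a • xDir + b • yDir)) := by
      intro v hv
      have := hpos v hv
      simp only [map_add, map_smul, smul_eq_mul] at this ⊢
      linarith
    refine not_exists_improving hφ hβ h hmin s (a • xDir + b • yDir) ?_ ?_ ?_
    · simpa [hεβ] using hpos' β (Finset.mem_insert_self _ _)
    · intro x hx hx1
      have := hpos' (σ • x + w) (Finset.mem_insert_of_mem
        (Finset.mem_image_of_mem _ (Finset.mem_filter.2 ⟨hYX hx, hx1⟩)))
      rw [hεY x hx] at this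
      linarith
    · intro x hx hxY hx1
      have := hpos' (σ • x + w) (Finset.mem_insert_of_mem
        (Finset.mem_image_of_mem _ (Finset.mem_filter.2 ⟨hx, hx1⟩)))
      rw [hεX x hxY] at this
      linarith
  · have hrel : IsRelation φ V fun v => l v * ε v := by
      intro s d
      have c1 := congrArg (fun q : ℝ × ℝ × ℝ => q.1) hl
      have c2 := congrArg (fun q : ℝ × ℝ × ℝ => q.2.1) hl
      have c3 := congrArg (fun q : ℝ × ℝ × ℝ => q.2.2) hl
      simp only [Prod.fst_sum, Prod.snd_sum, Prod.smul_mk, smul_eq_mul, Prod.fst_zero,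
        Prod.snd_zero] at c1 c2 c3
      have : ∀ v, l v * ε v * fderiv ℝ φ v (s • v + d) =
          s * (l v * (ε v * fderiv ℝ φ v v)) + d 0 * (l v * (ε v * fderiv ℝ φ v xDir)) +
            d 1 * (l v * (ε v * fderiv ℝ φ v yDir)) := by
        intro v
        rw [map_add, map_smul, apply_eq_coord _ d, smul_eq_mul]
        ring
      simp only [this, Finset.sum_add_distrib, ← Finset.mul_sum, c1, c2, c3]
      ring
    have hnz : ∃ v ∈ V, l v * ε v ≠ 0 := by
      by_contra! hz
      have : ∑ v ∈ V, l v = 0 := Finset.sum_eq_zero fun v hv => by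
        rcases mul_eq_zero.1 (hz v hv) with h0 | h0
        · exact h0
        · simp only [hε] at h0
          split_ifs at h0 <;> norm_num at h0
      linarith
    have hp2 := hrel.two_le_card_pos hφ hV1 hnz
    have hn2 := hrel.two_le_card_neg hφ hV1 hnz
    have hsum := IsRelation.card_pos_add_card_neg_le V fun v => l v * ε v
    have hQ3 : Q.card ≤ 3 := hX.boundary σ w h.pos
    have hQi : (Q.image fun x => σ • x + w).card = Q.card :=
      Finset.card_image_of_injective _ hinj
    have hVle : V.card ≤ Q.card + 1 := by
      rw [← hQi]
      exact Finset.card_insert_le _ _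
    have hβQ : β ∉ Q.image fun x => σ • x + w := by
      intro hmem
      rw [hV, Finset.insert_eq_of_mem hmem] at hsum hp2 hn2
      omega
    have hposneg : ∀ v ∈ V, 0 < l v * ε v ∨ l v * ε v < 0 := by
      intro v hv
      by_contra! hc
      have hsub := IsRelation.card_pos_add_card_neg_le (V.erase v) fun v => l v * ε v
      have e1 : (V.erase v).filter (fun v => 0 < l v * ε v) =
          V.filter fun v => 0 < l v * ε v := by
        rw [Finset.filter_erase, Finset.erase_eq_of_notMem]
        simp [hc.1]
      have e2 : (V.erase v).filter (fun v => l v * ε v < 0) =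
          V.filter fun v => l v * ε v < 0 := by
        rw [Finset.filter_erase, Finset.erase_eq_of_notMem]
        simp [hc.2]
      rw [e1, e2, Finset.card_erase_of_mem hv] at hsub
      omega
    have hsignY : ∀ x ∈ Q, (x ∈ Y ↔ l (σ • x + w) * ε (σ • x + w) < 0) := by
      intro x hx
      have hmem : σ • x + w ∈ V := Finset.mem_insert_of_mem (Finset.mem_image_of_mem _ hx)
      have h0 := hl0 _ hmem
      constructor
      · intro hxY
        refine (hposneg _ hmem).resolve_left fun hc => ?_
        rw [hεY x hxY] at hc
        linarith
      · intro hc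
        by_contra hxY
        rw [hεX x hxY] at hc
        linarith
    have hβpos : 0 < l β * ε β := by
      refine (hposneg β (Finset.mem_insert_self _ _)).resolve_right fun hc => ?_
      have := hl0 β (Finset.mem_insert_self _ _)
      rw [hεβ] at hc
      linarith
    have hnegcard : (Q.filter fun x => x ∈ Y).card =
        (V.filter fun v => l v * ε v < 0).card := by
      rw [← Finset.card_image_of_injective _ hinj]
      congr 1
      ext v
      simp only [Finset.mem_image, Finset.mem_filter, hV, Finset.mem_insert]
      constructor
      · rintro ⟨x, ⟨hx, hxY⟩, rfl⟩
        exact ⟨Or.inr ⟨x, hx, rfl⟩, (hsignY x hx).1 hxY⟩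
      · rintro ⟨rfl | ⟨x, hx, rfl⟩, hneg⟩
        · exact absurd hneg (not_lt.2 hβpos.le)
        · exact ⟨x, ⟨hx, (hsignY x hx).2 hneg⟩, rfl⟩
    have hYsplit : Y.card = (X.filter fun x => φ (σ • x + w) < 1).card +
        (Q.filter fun x => x ∈ Y).card := by
      rw [← Finset.card_union_of_disjoint]
      · congr 1
        ext x
        simp only [hQ, Finset.mem_union, Finset.mem_filter]
        constructor
        · intro hx
          rcases (h.le_one x hx).lt_or_eq with hlt | heq
          · exact Or.inl ⟨hYX hx, hlt⟩
          · exact Or.inr ⟨⟨hYX hx, heq⟩, hx⟩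
        · rintro (⟨hx, hlt⟩ | ⟨-, hx⟩)
          · by_contra hxY
            exact absurd (h.one_le x hx hxY) (not_le.2 hlt)
          · exact hx
      · rw [Finset.disjoint_left]
        intro x hx hx'
        simp only [hQ, Finset.mem_filter] at hx hx'
        linarith [hx.2, hx'.1.2]
    refine ⟨h, ⟨h.pos, ?_, ?_⟩, ?_, fun v => l v * ε v, hβpos, hrel, ?_⟩
    · change 3 ≤ Q.card
      omega
    · simp only
      omega
    · intro x hx he
      refine hβQ (Finset.mem_image.2 ⟨x, Finset.mem_filter.2 ⟨hx, ?_⟩, he⟩)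
      simp only at he
      rw [he]
      exact hβ.1
    · intro x hx hx1
      exact hsignY x (Finset.mem_filter.2 ⟨hx, hx1⟩)

lemma IsExtremal.eq {φ : Pt → ℝ} (hφ : IsSmoothGauge φ) {β : Pt} (hβ : IsRightmost φ β)
    {X Y Y' : Finset Pt} (hX : GeneralPosition φ X) {m : ℕ} {θ : ℝ × Pt} (hYX : Y ⊆ X)
    (hY'X : Y' ⊆ X) (h : IsExtremal φ β X m Y θ) (h' : IsExtremal φ β X m Y' θ) : Y = Y' := by
  classical
  have key : ∀ {Y Y' : Finset Pt}, Y ⊆ X → IsExtremal φ β X m Y θ →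
      IsExtremal φ β X m Y' θ → Y ⊆ Y' := by
    intro Y Y' hYX h h' x hx
    rcases (h.capture.le_one x hx).lt_or_eq with hlt | heq
    · by_contra hxY
      exact absurd (h'.capture.one_le x (hYX hx) hxY) (not_le.2 hlt)
    · obtain ⟨ρ, hρβ, hρ, hρs⟩ := h.exists_relation
      obtain ⟨ρ', hρβ', hρ', hρs'⟩ := h'.exists_relation
      rw [hρs' x (hYX hx) heq]
      refine hρ.neg_of_neg hφ ?_ ?_ ?_ hρ' hρβ hρβ' ?_ ((hρs x (hYX hx) heq).1 hx)
      · intro v hv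
        rcases Finset.mem_insert.1 hv with rfl | hv
        · exact hβ.1
        · obtain ⟨u, hu, rfl⟩ := Finset.mem_image.1 hv
          exact (Finset.mem_filter.1 hu).2
      · intro hmem
        obtain ⟨u, hu, he⟩ := Finset.mem_image.1 hmem
        exact h.ne_rightmost u (Finset.mem_filter.1 hu).1 he
      · exact Finset.card_image_le.trans (hX.boundary _ _ h.capture.pos)
      · exact Finset.mem_image_of_mem _ (Finset.mem_filter.2 ⟨hYX hx, heq⟩)
  exact (key hYX h h').antisymm (key hY'X h' h)

lemma exists_isApex_or_exists_isExtremal {φ : Pt → ℝ} (hφ : IsSmoothGauge φ) {β : Pt}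
    (hβ : IsRightmost φ β) {X Y : Finset Pt} (hX : GeneralPosition φ X) {m : ℕ} (hm : 1 ≤ m)
    (hYX : Y ⊆ X) (hYm : Y.card = m + 1) {σ₁ : ℝ} {w₁ : Pt} (h₁ : WeakCapture φ X Y σ₁ w₁) :
    (∃ y σ, IsApex φ β X Y y σ) ∨ ∃ θ, IsExtremal φ β X m Y θ := by
  by_cases hinit : ∃ y ∈ Y, ∃ x ∈ X, x ∉ Y ∧ x 0 < y 0
  · obtain ⟨σ, w, h, hmin⟩ := exists_min_extent hφ hβ h₁ (by omega) hinit
    by_cases hne : ∀ y ∈ Y, σ • y + w ≠ β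
    · exact Or.inr ⟨_, isExtremal_of_min hφ hβ hX hYX hYm h hmin hne⟩
    · push Not at hne
      obtain ⟨y, hy, he⟩ := hne
      refine Or.inl ⟨y, σ, hy, ?_⟩
      rwa [← he, add_sub_cancel_left]
  · push Not at hinit
    left
    obtain ⟨y, hy, hymax⟩ := Y.exists_max_image (fun y : Pt => y 0)
      (Finset.card_pos.1 (by omega))
    obtain ⟨hβ1, c, hc, hβc⟩ := hβ
    have e1 : ∀ᶠ t in nhdsWithin (0 : ℝ) (Ioi 0), ∀ u ∈ Y, φ (β + t • (u - y)) ≤ 1 := by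
      rw [Finset.eventually_all]
      intro u hu
      by_cases huy : u = y
      · simp [huy, hβ1]
      · have hlt : u 0 < y 0 := lt_of_le_of_ne (hymax u hu) fun he =>
          huy (hX.injX u (hYX hu) y (hYX hy) he)
        have : fderiv ℝ φ β (u - y) < 0 := by
          rw [hβc, PiLp.sub_apply]
          exact mul_neg_of_pos_of_neg hc (by linarith)
        have := hφ.eventually_lt this
        rw [hβ1] at this
        exact this.mono fun _ h => h.le
    obtain ⟨t, ht1, ht0⟩ := (e1.and self_mem_nhdsWithin).exists
    have e : ∀ u : Pt, t • u + (β - t • y) = β + t • (u - y) := fun u => by module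
    refine ⟨y, t, hy, ht0, fun u hu => by rw [e]; exact ht1 u hu, fun x hx hxY => ?_⟩
    rw [e]
    have hlt : y 0 < x 0 := lt_of_le_of_ne (hinit y hy x hx hxY) fun he =>
      hxY (hX.injX y (hYX hy) x hx he ▸ hy)
    have : 0 < fderiv ℝ φ β (x - y) := by
      rw [hβc, PiLp.sub_apply]
      exact mul_pos hc (by linarith)
    have := hφ.eventually_gt this t ht0
    rw [hβ1] at this
    exact this.le

namespace IsApex

variable {φ : Pt → ℝ} {β y : Pt} {X Y Y' : Finset Pt} {m : ℕ} {σ σ' : ℝ}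

lemma card_le_card_left (hφ : IsSmoothGauge φ) (hβ : IsRightmost φ β) (hYX : Y ⊆ X)
    (hYm : Y.card = m + 1) (h : IsApex φ β X Y y σ) :
    m ≤ (X.filter fun x => x 0 < y 0).card := by
  classical
  have hsub : Y.erase y ⊆ X.filter fun x => x 0 < y 0 := by
    intro u hu
    obtain ⟨huy, huY⟩ := Finset.mem_erase.1 hu
    refine Finset.mem_filter.2 ⟨hYX huY, ?_⟩
    have hpos := h.2.pos
    have hne : σ • u + (β - σ • y) ≠ β := by
      intro he
      apply huy
      have : σ • (u - y) = 0 := by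
        have e : σ • (u - y) = (σ • u + (β - σ • y)) - β := by module
        rw [e, he, sub_self]
      simpa [hpos.ne', sub_eq_zero] using this
    have := hβ.lt hφ (h.2.le_one u huY) hne
    simp only [PiLp.add_apply, PiLp.sub_apply, PiLp.smul_apply, smul_eq_mul] at this
    by_contra! hc
    nlinarith
  have := Finset.card_le_card hsub
  rwa [Finset.card_erase_of_mem h.1, hYm, Nat.add_sub_cancel] at this

lemma subset_of_scale_lt (hφ : IsSmoothGauge φ) (hβ : IsRightmost φ β) (hY'X : Y' ⊆ X)
    (h : IsApex φ β X Y y σ) (h' : IsApex φ β X Y' y σ') (hlt : σ < σ') : Y' ⊆ Y := by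
  intro u hu
  by_contra huY
  have hne : u - y ≠ 0 := sub_ne_zero.2 (by rintro rfl; exact huY h.1)
  have h1 := h'.2.le_one u hu
  have h2 := h.2.one_le u (hY'X hu) huY
  have e : ∀ σ : ℝ, σ • u + (β - σ • y) = β + σ • (u - y) := fun σ => by module
  rw [e] at h1 h2
  have := hφ.level_lt_of_scale_lt hβ.1 h.2.pos.le hlt hne
    (by rw [level_of_pos _ _ _ h'.2.pos]; linarith)
  rw [level_of_pos _ _ _ h.2.pos] at this
  linarith

lemma scale_eq (hφ : IsSmoothGauge φ) (hβ : IsRightmost φ β) (hYX : Y ⊆ X) (hY'X : Y' ⊆ X)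
    (hcard : Y.card = Y'.card) (hne : Y ≠ Y') (h : IsApex φ β X Y y σ)
    (h' : IsApex φ β X Y' y σ') : σ = σ' := by
  rcases lt_trichotomy σ σ' with hlt | heq | hlt
  · exact absurd (Finset.eq_of_subset_of_card_le
      (h.subset_of_scale_lt hφ hβ hY'X h' hlt) hcard.le).symm hne
  · exact heq
  · exact absurd (Finset.eq_of_subset_of_card_le
      (h'.subset_of_scale_lt hφ hβ hYX h hlt) hcard.ge) hne

end IsApex

/-- At most two sets have the same apex, and if there are two then there is a triple whose
rightmost point is the apex. -/
lemma card_le_one_or_exists_isTriple {φ : Pt → ℝ} (hφ : IsSmoothGauge φ) {β y : Pt}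
    (hβ : IsRightmost φ β) {X : Finset Pt} (hX : GeneralPosition φ X) {m : ℕ}
    {C : Finset (Finset Pt)}
    (hC : ∀ Y ∈ C, Y ⊆ X ∧ Y.card = m + 1 ∧ ∃ σ, IsApex φ β X Y y σ) :
    C.card ≤ 1 ∨ C.card ≤ 2 ∧ ∃ σ, IsTriple φ X m (σ, β - σ • y) := by
  classical
  by_cases h1 : C.card ≤ 1
  · exact Or.inl h1
  right
  obtain ⟨Y₁, hY₁, Y₂, hY₂, hne⟩ := Finset.one_lt_card.1 (not_le.1 h1)
  obtain ⟨hY₁X, hY₁m, σ, hσ⟩ := hC Y₁ hY₁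
  have hall : ∀ Y ∈ C, IsApex φ β X Y y σ := by
    intro Y hY
    obtain ⟨hYX, hYm, σ', hσ'⟩ := hC Y hY
    by_cases he : Y₁ = Y
    · exact he ▸ hσ
    · rw [hσ.scale_eq hφ hβ hY₁X hYX (hY₁m.trans hYm.symm) he hσ']
      exact hσ'
  set I := X.filter fun x => φ (σ • x + (β - σ • y)) < 1 with hI
  set Q := X.filter fun x => φ (σ • x + (β - σ • y)) = 1 with hQ
  have hyφ : φ (σ • y + (β - σ • y)) = 1 := by
    rw [add_sub_cancel]
    exact hβ.1
  have hyQ : y ∈ Q := Finset.mem_filter.2 ⟨hY₁X hσ.1, hyφ⟩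
  have hQ3 : Q.card ≤ 3 := hX.boundary _ _ hσ.2.pos
  have hsplit : ∀ Y ∈ C, Y = insert y I ∪ Y.filter fun x => x ∈ Q.erase y := by
    intro Y hY
    have hA := hall Y hY
    ext x
    simp only [hI, hQ, Finset.mem_union, Finset.mem_insert, Finset.mem_filter, Finset.mem_erase]
    constructor
    · intro hx
      by_cases hxy : x = y
      · exact Or.inl (Or.inl hxy)
      · rcases (hA.2.le_one x hx).lt_or_eq with hlt | heq
        · exact Or.inl (Or.inr ⟨(hC Y hY).1 hx, hlt⟩)
        · exact Or.inr ⟨hx, hxy, (hC Y hY).1 hx, heq⟩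
    · rintro ((rfl | ⟨hx, hlt⟩) | ⟨hx, -⟩)
      · exact hA.1
      · by_contra hxY
        exact absurd (hA.2.one_le x hx hxY) (not_le.2 hlt)
      · exact hx
  have hcardI : (insert y I).card = I.card + 1 :=
    Finset.card_insert_of_notMem (by simp [hI, hβ.1])
  have hcards : ∀ Y ∈ C, I.card + 1 + (Y.filter fun x => x ∈ Q.erase y).card = m + 1 := by
    intro Y hY
    rw [← (hC Y hY).2.1, ← hcardI, ← Finset.card_union_of_disjoint, ← hsplit Y hY]
    rw [Finset.disjoint_left]
    intro x hx hx'
    simp only [hI, hQ, Finset.mem_insert, Finset.mem_filter, Finset.mem_erase] at hx hx'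
    rcases hx with hx | hx
    · exact hx'.2.1 hx
    · linarith [hx.2, hx'.2.2.2]
  have hle : C.card ≤ (Finset.powersetCard (m - I.card) (Q.erase y)).card := by
    refine Finset.card_le_card_of_injOn (fun Y => Y.filter fun x => x ∈ Q.erase y) ?_ ?_
    · intro Y hY
      have := hcards Y hY
      simp only [Finset.mem_coe, Finset.mem_powersetCard]
      refine ⟨fun x hx => (Finset.mem_filter.1 hx).2, by omega⟩
    · intro Y hY Y' hY' he
      rw [hsplit Y hY, hsplit Y' hY']
      simp only at he
      rw [he]
  rw [Finset.card_powersetCard, Finset.card_erase_of_mem hyQ] at hle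
  have hI1 := hcards Y₁ hY₁
  generalize hj : m - I.card = j at hle
  generalize C.card = c at hle h1 ⊢
  have hq : Q.card - 1 = 0 ∨ Q.card - 1 = 1 ∨ Q.card - 1 = 2 := by omega
  rcases hq with hq | hq | hq
  · rw [hq] at hle
    rcases j with _ | j <;> simp at hle <;> omega
  · rw [hq] at hle
    rcases j with _ | _ | j <;> simp [Nat.choose] at hle <;> omega
  · rw [hq] at hle
    have hj1 : j = 1 := by
      rcases j with _ | _ | _ | j <;> simp [Nat.choose] at hle ⊢ <;> omega
    subst hj1
    refine ⟨by simpa using hle, σ, hσ.2.pos, ?_, ?_⟩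
    · change 3 ≤ Q.card
      omega
    · change I.card + 1 = m
      omega

/-- Captured sets are counted by the points with at least `m` points to their left and by
triples. -/
lemma exists_triples_card_captured_le {φ : Pt → ℝ} (hφ : IsSmoothGauge φ) {X : Finset Pt}
    (hX : GeneralPosition φ X) {m : ℕ} (hm : 1 ≤ m) {𝓕 : Finset (Finset Pt)}
    (h𝓕 : ∀ Y ∈ 𝓕, Y ⊆ X ∧ Y.card = m + 1 ∧ ∃ σ w, WeakCapture φ X Y σ w) :
    ∃ Θ : Finset (ℝ × Pt), (∀ θ ∈ Θ, IsTriple φ X m θ) ∧ 𝓕.card ≤ (X.card - m) + Θ.card := by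
  classical
  obtain ⟨β, hβ⟩ := IsRightmost.exists_of_gauge hφ
  set 𝓐 := 𝓕.filter fun Y => ∃ y σ, IsApex φ β X Y y σ with h𝓐
  set 𝓝 := 𝓕.filter fun Y => ¬ ∃ y σ, IsApex φ β X Y y σ with h𝓝
  have hsplit : 𝓐.card + 𝓝.card = 𝓕.card := Finset.card_filter_add_card_filter_not _
  have hext : ∀ Y ∈ 𝓝, ∃ θ, IsExtremal φ β X m Y θ := by
    intro Y hY
    obtain ⟨hY, hn⟩ := Finset.mem_filter.1 hY
    obtain ⟨hYX, hYm, σ, w, hw⟩ := h𝓕 Y hY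
    exact (exists_isApex_or_exists_isExtremal hφ hβ hX hm hYX hYm hw).resolve_left hn
  choose! θ hθ using hext
  have hapex : ∀ Y ∈ 𝓐, ∃ y, ∃ σ, IsApex φ β X Y y σ := fun Y hY => (Finset.mem_filter.1 hY).2
  choose! y hy using hapex
  set A := X.filter fun p => m ≤ (X.filter fun x => x 0 < p 0).card with hA
  have hyA : ∀ Y ∈ 𝓐, y Y ∈ A := by
    intro Y hY
    obtain ⟨σ, hσ⟩ := hy Y hY
    obtain ⟨hYX, hYm, -⟩ := h𝓕 Y (Finset.mem_filter.1 hY).1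
    exact Finset.mem_filter.2 ⟨hYX hσ.1, hσ.card_le_card_left hφ hβ hYX hYm⟩
  have hAcard : A.card ≤ X.card - m := by
    rw [← Nat.card_Ico]
    refine Finset.card_le_card_of_injOn (fun p => (X.filter fun x => x 0 < p 0).card) ?_ ?_
    · intro p hp
      obtain ⟨hpX, hpm⟩ := Finset.mem_filter.1 hp
      exact Finset.mem_coe.2 (Finset.mem_Ico.2 ⟨hpm, card_left_lt hpX⟩)
    · exact (injOn_card_left hX.injX).mono fun p hp => (Finset.mem_filter.1 hp).1
  set B := A.filter fun p => 1 < (𝓐.filter fun Y => y Y = p).card with hB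
  have hfib : ∀ p, (𝓐.filter fun Y => y Y = p).card ≤ 1 ∨
      (𝓐.filter fun Y => y Y = p).card ≤ 2 ∧ ∃ σ, IsTriple φ X m (σ, β - σ • p) := by
    intro p
    refine card_le_one_or_exists_isTriple hφ hβ hX fun Y hY => ?_
    obtain ⟨hY', rfl⟩ := Finset.mem_filter.1 hY
    obtain ⟨hYX, hYm, -⟩ := h𝓕 Y (Finset.mem_filter.1 hY').1
    exact ⟨hYX, hYm, hy Y hY'⟩
  have hBσ : ∀ p ∈ B, ∃ σ, IsTriple φ X m (σ, β - σ • p) := by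
    intro p hp
    have := (Finset.mem_filter.1 hp).2
    rcases hfib p with h | h
    · omega
    · exact h.2
  choose! τ hτ using hBσ
  have h𝓐card : 𝓐.card ≤ A.card + B.card := by
    have hBcard : B.card = ∑ p ∈ A, if 1 < (𝓐.filter fun Y => y Y = p).card then 1 else 0 :=
      Finset.card_filter _ _
    rw [Finset.card_eq_sum_card_fiberwise hyA, hBcard, Finset.card_eq_sum_ones A,
      ← Finset.sum_add_distrib]
    refine Finset.sum_le_sum fun p _ => ?_
    rcases hfib p with h | h
    · omega
    · split_ifs <;> omega
  have i1 : Set.InjOn θ 𝓝 := by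
    intro Y hY Y' hY' he
    refine IsExtremal.eq hφ hβ hX (h𝓕 Y (Finset.mem_filter.1 hY).1).1
      (h𝓕 Y' (Finset.mem_filter.1 hY').1).1 (hθ Y hY) ?_
    rw [he]
    exact hθ Y' hY'
  have i2 : Set.InjOn (fun p => (τ p, β - τ p • p)) B := by
    intro p hp p' hp' he
    simp only [Prod.mk.injEq] at he
    have hpos := (hτ p hp).pos
    obtain ⟨e1, e2⟩ := he
    rw [← e1] at e2
    have := sub_right_injective e2
    exact smul_right_injective _ hpos.ne' this
  refine ⟨𝓝.image θ ∪ B.image fun p => (τ p, β - τ p • p), ?_, ?_⟩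
  · intro t ht
    rcases Finset.mem_union.1 ht with ht | ht
    · obtain ⟨Y, hY, rfl⟩ := Finset.mem_image.1 ht
      exact (hθ Y hY).triple
    · obtain ⟨p, hp, rfl⟩ := Finset.mem_image.1 ht
      exact hτ p hp
  · rw [Finset.card_union_of_disjoint, Finset.card_image_of_injOn i1,
      Finset.card_image_of_injOn i2]
    · omega
    · rw [Finset.disjoint_left]
      intro t ht ht'
      obtain ⟨Y, hY, rfl⟩ := Finset.mem_image.1 ht
      obtain ⟨p, hp, he⟩ := Finset.mem_image.1 ht'
      have hpX : p ∈ X := (Finset.mem_filter.1 (Finset.mem_filter.1 hp).1).1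
      apply (hθ Y hY).ne_rightmost p hpX
      rw [← he]
      simp

/-- The bound for points in general position. -/
lemma card_captured_add_card_separated_le {φ : Pt → ℝ} (hφ : IsSmoothGauge φ) {X : Finset Pt}
    (hX : GeneralPosition φ X) {m : ℕ} (hm : 1 ≤ m) (hmX : m < X.card)
    {𝓕 𝓗 : Finset (Finset Pt)}
    (h𝓕 : ∀ Y ∈ 𝓕, Y ⊆ X ∧ Y.card = m + 1 ∧ ∃ σ w, WeakCapture φ X Y σ w)
    (h𝓗 : ∀ H ∈ 𝓗, H ⊆ X ∧ H.Nonempty ∧ H.card ≤ m ∧ ∃ α β, SeparatedBy X H α β) :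
    𝓕.card + 𝓗.card + m * (m + 1) ≤ (X.card - m) + 2 * m * X.card := by
  obtain ⟨Θ, hΘ, hle⟩ := exists_triples_card_captured_le hφ hX hm h𝓕
  have h1 := card_triples_add_card_separated_le hφ hX hmX hΘ h𝓗
  have h2 := two_mul_sum_min m X.card hmX
  omega

/-- A positive homothety taking three given points in convex position to the boundary of
`{φ ≤ 1}` is unique, when the middle point lies below the other two. -/
lemma IsSmoothGauge.homothety_unique_of_below {φ : Pt → ℝ} (hφ : IsSmoothGauge φ) {p l r : Pt}
    (hl : l 0 < p 0) (hr : p 0 < r 0)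
    (hD : 0 < (r 0 - p 0) * (l 1 - p 1) - (l 0 - p 0) * (r 1 - p 1)) {σ σ' : ℝ} {w w' : Pt}
    (hσ : 0 < σ) (hσ' : 0 < σ') (hp : φ (σ • p + w) = 1) (hlφ : φ (σ • l + w) = 1)
    (hrφ : φ (σ • r + w) = 1) (hp' : φ (σ' • p + w') = 1) (hlφ' : φ (σ' • l + w') = 1)
    (hrφ' : φ (σ' • r + w') = 1) : σ = σ' ∧ w = w' := by
  have e : ∀ (σ : ℝ) (w z : Pt), σ • z + w = (σ • p + w) + σ • (z - p) := fun σ w z => by module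
  have hlne : l - p ≠ 0 := sub_ne_zero.2 (by rintro rfl; exact lt_irrefl _ hl)
  have hrne : r - p ≠ 0 := sub_ne_zero.2 (by rintro rfl; exact lt_irrefl _ hr)
  have hl0 : (l - p) 0 < 0 := by simpa using hl
  have hr0 : 0 < (r - p) 0 := by simpa using hr
  have low : ∀ {σ : ℝ} {b : Pt}, 0 < σ → φ b = 1 → φ (b + σ • (l - p)) = 1 →
      φ (b + σ • (r - p)) = 1 → fderiv ℝ φ b yDir < 0 := by
    intro σ b hσ hb h1 h2
    have d1 := hφ.fderiv_neg_of_le hσ hlne (h1.trans hb.symm).le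
    have d2 := hφ.fderiv_neg_of_le hσ hrne (h2.trans hb.symm).le
    rw [apply_eq_coord] at d1 d2
    simp only [PiLp.sub_apply] at d1 d2
    by_contra! hc
    nlinarith
  rw [e] at hlφ hrφ hlφ' hrφ'
  have hlow := low hσ hp hlφ hrφ
  have hlow' := low hσ' hp' hlφ' hrφ'
  have hbb : σ • p + w = σ' • p + w' := by
    rcases lt_trichotomy ((σ • p + w) 0) ((σ' • p + w') 0) with h | h | h
    · exact absurd hrφ (hφ.right_before_left hp' hp hlow' hlow h hσ' hσ hl0 hr0 hrφ'.le hlφ'.ge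
        hlφ.le).ne
    · exact hφ.lower_unique hp hp' hlow hlow' h
    · exact absurd hrφ' (hφ.right_before_left hp hp' hlow hlow' h hσ hσ' hl0 hr0 hrφ.le hlφ.ge
        hlφ'.le).ne
  rw [← hbb] at hrφ'
  have scale : ∀ {s s' : ℝ}, 0 < s → φ ((σ • p + w) + s • (r - p)) = 1 →
      φ ((σ • p + w) + s' • (r - p)) = 1 → ¬ s < s' := by
    intro s s' hs h h' hlt
    have := hφ.level_lt_of_scale_lt hp hs.le hlt hrne
      (by rw [level_of_pos _ _ _ (hs.trans hlt)]; linarith)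
    rw [level_of_pos _ _ _ hs] at this
    linarith
  have hs : σ = σ' := le_antisymm (not_lt.1 (scale hσ' hrφ' hrφ)) (not_lt.1 (scale hσ hrφ hrφ'))
  subst hs
  exact ⟨rfl, add_left_cancel hbb⟩

lemma IsSmoothGauge.homothety_unique_of_lt {φ : Pt → ℝ} (hφ : IsSmoothGauge φ) {p l r : Pt}
    (hl : l 0 < p 0) (hr : p 0 < r 0)
    (hD : (l 0 - p 0) * (r 1 - p 1) - (l 1 - p 1) * (r 0 - p 0) ≠ 0) {σ σ' : ℝ} {w w' : Pt}
    (hσ : 0 < σ) (hσ' : 0 < σ') (hp : φ (σ • p + w) = 1) (hlφ : φ (σ • l + w) = 1)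
    (hrφ : φ (σ • r + w) = 1) (hp' : φ (σ' • p + w') = 1) (hlφ' : φ (σ' • l + w') = 1)
    (hrφ' : φ (σ' • r + w') = 1) : σ = σ' ∧ w = w' := by
  rcases hD.lt_or_gt with hD | hD
  · exact hφ.homothety_unique_of_below hl hr (by linarith) hσ hσ' hp hlφ hrφ hp' hlφ' hrφ'
  · have e : ∀ (σ : ℝ) (w z : Pt), -(σ • (-z) + -w) = σ • z + w := fun σ w z => by module
    have := hφ.comp_neg.homothety_unique_of_below (p := -p) (l := -r) (r := -l)
      (w := -w) (w' := -w') (by simpa using hr) (by simpa using hl)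
      (by simp only [PiLp.neg_apply]; linarith) hσ hσ' (by rwa [e]) (by rwa [e]) (by rwa [e])
      (by rwa [e]) (by rwa [e]) (by rwa [e])
    exact ⟨this.1, neg_injective this.2⟩

lemma GeneralPosition.homothety_unique {φ : Pt → ℝ} {X : Finset Pt} (hX : GeneralPosition φ X)
    (hφ : IsSmoothGauge φ) {p q r : Pt} (hpX : p ∈ X) (hqX : q ∈ X) (hrX : r ∈ X) (hpq : p ≠ q)
    (hpr : p ≠ r) (hqr : q ≠ r) {σ σ' : ℝ} {w w' : Pt}
    (hσ : 0 < σ) (hσ' : 0 < σ') (hp : φ (σ • p + w) = 1) (hq : φ (σ • q + w) = 1)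
    (hr : φ (σ • r + w) = 1) (hp' : φ (σ' • p + w') = 1) (hq' : φ (σ' • q + w') = 1)
    (hr' : φ (σ' • r + w') = 1) : σ = σ' ∧ w = w' := by
  have hN := hX.noncollinear
  rcases lt_or_gt_of_ne (mt (hX.injX p hpX q hqX) hpq) with h1 | h1 <;>
  rcases lt_or_gt_of_ne (mt (hX.injX p hpX r hrX) hpr) with h2 | h2 <;>
  rcases lt_or_gt_of_ne (mt (hX.injX q hqX r hrX) hqr) with h3 | h3
  · exact hφ.homothety_unique_of_lt h1 h3 (hN q hqX p hpX r hrX hpq.symm hqr hpr)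
      hσ hσ' hq hp hr hq' hp' hr'
  · exact hφ.homothety_unique_of_lt h2 h3 (hN r hrX p hpX q hqX hpr.symm hqr.symm hpq)
      hσ hσ' hr hp hq hr' hp' hq'
  · linarith
  · exact hφ.homothety_unique_of_lt h2 h1 (hN p hpX r hrX q hqX hpr hpq hqr.symm)
      hσ hσ' hp hr hq hp' hr' hq'
  · exact hφ.homothety_unique_of_lt h1 h2 (hN p hpX q hqX r hrX hpq hpr hqr)
      hσ hσ' hp hq hr hp' hq' hr'
  · linarith
  · exact hφ.homothety_unique_of_lt h3 h2 (hN r hrX q hqX p hpX hqr.symm hpr.symm hpq.symm)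
      hσ hσ' hr hq hp hr' hq' hp'
  · exact hφ.homothety_unique_of_lt h3 h1 (hN q hqX r hrX p hpX hqr hpq.symm hpr.symm)
      hσ hσ' hq hr hp hq' hr' hp'

lemma dense_ne_of_forall_exists {g : Pt → ℝ} {c : ℝ}
    (h : ∀ z, g z = c → ∃ v : Pt, ∀ t : ℝ, 0 < t → g (z + t • v) ≠ c) : Dense {z | g z ≠ c} := by
  intro z
  by_cases hz : g z = c
  · obtain ⟨v, hv⟩ := h z hz
    have ht : Filter.Tendsto (fun t : ℝ => z + t • v) (nhdsWithin 0 (Ioi 0)) (nhds z) := by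
      have : ContinuousAt (fun t : ℝ => z + t • v) 0 := by fun_prop
      simpa using this.tendsto.mono_left nhdsWithin_le_nhds
    refine mem_closure_of_tendsto ht ?_
    filter_upwards [self_mem_nhdsWithin] with t ht
    exact hv t ht
  · exact subset_closure hz

lemma IsSmoothGauge.dense_ne_one {φ : Pt → ℝ} (hφ : IsSmoothGauge φ) {σ : ℝ} (hσ : 0 < σ)
    (w : Pt) : Dense {z : Pt | φ (σ • z + w) ≠ 1} := by
  refine dense_ne_of_forall_exists fun z hz => ?_
  obtain ⟨z₀, hz₀⟩ := hφ.exists_lt_one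
  have hd := hφ.fderiv_sub_neg (u := z₀) (b := σ • z + w) (by rintro rfl; linarith)
    (by linarith)
  refine ⟨(σ • z + w) - z₀, fun t ht => ?_⟩
  have := hφ.eventually_gt (b := σ • z + w) (w := (σ • z + w) - z₀)
    (by rw [← neg_sub, map_neg]; linarith) (σ * t) (by positivity)
  have e : σ • (z + t • ((σ • z + w) - z₀)) + w
      = (σ • z + w) + (σ * t) • ((σ • z + w) - z₀) := by module
  rw [e]
  linarith

/-- Finite sets in general position stay in general position when adding a generic point. -/
lemma GeneralPosition.dense_insert {φ : Pt → ℝ} (hφ : IsSmoothGauge φ) {E : Finset Pt}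
    (hE : GeneralPosition φ E) : Dense {z | z ∉ E ∧ GeneralPosition φ (insert z E)} := by
  classical
  have hcont : Continuous φ := hφ.contDiff.continuous
  let V : Pt → Set Pt := fun p => {z | z 0 ≠ p 0}
  let L : Pt × Pt → Set Pt := fun p =>
    {z | (p.2 0 - p.1 0) * (z 1 - p.1 1) - (p.2 1 - p.1 1) * (z 0 - p.1 0) ≠ 0}
  let T : Pt × Pt × Pt → Set Pt := fun p => {z | ∀ (σ : ℝ) (w : Pt), 0 < σ →
    φ (σ • p.1 + w) = 1 → φ (σ • p.2.1 + w) = 1 → φ (σ • p.2.2 + w) = 1 → φ (σ • z + w) ≠ 1}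
  let J := (E ×ˢ E ×ˢ E).filter fun p => p.1 ≠ p.2.1 ∧ p.1 ≠ p.2.2 ∧ p.2.1 ≠ p.2.2
  have hV : ∀ p ∈ E, IsOpen (V p) ∧ Dense (V p) := by
    intro p _
    refine ⟨isOpen_ne_fun (by fun_prop) (by fun_prop), ?_⟩
    refine dense_ne_of_forall_exists (g := fun z : Pt => z 0) fun z hz => ⟨xDir, fun t ht => ?_⟩
    simp [hz, ht.ne']
  have hL : ∀ p ∈ E.offDiag, IsOpen (L p) ∧ Dense (L p) := by
    rintro ⟨p, q⟩ hpq
    obtain ⟨hp, hq, hne⟩ := Finset.mem_offDiag.1 hpq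
    refine ⟨isOpen_ne_fun (by fun_prop) (by fun_prop), ?_⟩
    have h0 : q 0 - p 0 ≠ 0 := sub_ne_zero.2 fun h => hne (hE.injX p hp q hq h.symm)
    refine dense_ne_of_forall_exists
      (g := fun z : Pt => (q 0 - p 0) * (z 1 - p 1) - (q 1 - p 1) * (z 0 - p 0))
      fun z hz => ⟨yDir, fun t ht => ?_⟩
    have : (q 0 - p 0) * ((z + t • yDir) 1 - p 1) - (q 1 - p 1) * ((z + t • yDir) 0 - p 0)
        = t * (q 0 - p 0) := by
      simp only [PiLp.add_apply, PiLp.smul_apply, smul_eq_mul, yDir_zero, yDir_one]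
      linear_combination hz
    simp only [this]
    exact mul_ne_zero ht.ne' h0
  have hT : ∀ p ∈ J, IsOpen (T p) ∧ Dense (T p) := by
    rintro ⟨p, q, r⟩ hpqr
    simp only [J, Finset.mem_filter, Finset.mem_product] at hpqr
    obtain ⟨⟨hp, hq, hr⟩, hpq, hpr, hqr⟩ := hpqr
    by_cases h : ∃ (σ : ℝ) (w : Pt), 0 < σ ∧ φ (σ • p + w) = 1 ∧ φ (σ • q + w) = 1 ∧
        φ (σ • r + w) = 1
    · obtain ⟨σ, w, hσ, h1, h2, h3⟩ := h
      have : T (p, q, r) = {z | φ (σ • z + w) ≠ 1} := by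
        ext z
        refine ⟨fun hz => hz σ w hσ h1 h2 h3, fun hz σ' w' hσ' h1' h2' h3' => ?_⟩
        obtain ⟨rfl, rfl⟩ :=
          hE.homothety_unique hφ hp hq hr hpq hpr hqr hσ hσ' h1 h2 h3 h1' h2' h3'
        exact hz
      rw [this]
      exact ⟨isOpen_ne_fun (by fun_prop) (by fun_prop), hφ.dense_ne_one hσ w⟩
    · have : T (p, q, r) = univ := by
        refine eq_univ_of_forall fun z σ w hσ h1 h2 h3 => ?_
        exact absurd ⟨σ, w, hσ, h1, h2, h3⟩ h
      rw [this]
      exact ⟨isOpen_univ, dense_univ⟩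
  have dV : Dense (⋂ p ∈ (E : Set Pt), V p) := dense_biInter_of_isOpen (fun p hp => (hV p hp).1)
    E.countable_toSet fun p hp => (hV p hp).2
  have dL : Dense (⋂ p ∈ (E.offDiag : Set (Pt × Pt)), L p) :=
    dense_biInter_of_isOpen (fun p hp => (hL p hp).1) E.offDiag.countable_toSet
      fun p hp => (hL p hp).2
  have dT : Dense (⋂ p ∈ (J : Set (Pt × Pt × Pt)), T p) :=
    dense_biInter_of_isOpen (fun p hp => (hT p hp).1) J.countable_toSet fun p hp => (hT p hp).2
  have oV : IsOpen (⋂ p ∈ (E : Set Pt), V p) :=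
    E.finite_toSet.isOpen_biInter fun p hp => (hV p hp).1
  have oL : IsOpen (⋂ p ∈ (E.offDiag : Set (Pt × Pt)), L p) :=
    E.offDiag.finite_toSet.isOpen_biInter fun p hp => (hL p hp).1
  refine (((dT.inter_of_isOpen_right dL oL).inter_of_isOpen_right dV oV)).mono ?_
  rintro z ⟨⟨zT, zL⟩, zV⟩
  simp only [mem_iInter] at zT zL zV
  have hzV : ∀ p ∈ E, z 0 ≠ p 0 := fun p hp => zV p hp
  have hzL : ∀ p ∈ E, ∀ q ∈ E, p ≠ q →
      (q 0 - p 0) * (z 1 - p 1) - (q 1 - p 1) * (z 0 - p 0) ≠ 0 := fun p hp q hq hpq =>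
    zL (p, q) (Finset.mem_coe.2 (Finset.mem_offDiag.2 ⟨hp, hq, hpq⟩))
  have hzE : z ∉ E := fun h => hzV z h rfl
  refine ⟨hzE, ⟨?_, ?_, ?_⟩⟩
  · intro x hx y hy h
    rcases Finset.mem_insert.1 hx with rfl | hxE <;> rcases Finset.mem_insert.1 hy with rfl | hyE
    · rfl
    · exact absurd h (hzV y hyE)
    · exact absurd h.symm (hzV x hxE)
    · exact hE.injX x hxE y hyE h
  · intro p hp q hq r hr hpq hpr hqr
    rcases Finset.mem_insert.1 hp with rfl | hpE
    · intro h
      exact hzL q (Finset.mem_of_mem_insert_of_ne hq hpq.symm) r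
        (Finset.mem_of_mem_insert_of_ne hr hpr.symm) hqr (by linear_combination h)
    · rcases Finset.mem_insert.1 hq with rfl | hqE
      · intro h
        exact hzL p hpE r (Finset.mem_of_mem_insert_of_ne hr hqr.symm) hpr
          (by linear_combination -h)
      · rcases Finset.mem_insert.1 hr with rfl | hrE
        · exact hzL p hpE q hqE hpq
        · exact hE.noncollinear p hpE q hqE r hrE hpq hpr hqr
  · intro σ w hσ
    rw [Finset.filter_insert]
    split_ifs with hz
    · by_contra! hc
      have hle := Finset.card_insert_le z (E.filter fun x => φ (σ • x + w) = 1)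
      obtain ⟨p, q, r, hp, hq, hr, hpq, hpr, hqr⟩ :=
        Finset.two_lt_card_iff.1 (show 2 < (E.filter fun x => φ (σ • x + w) = 1).card by omega)
      rw [Finset.mem_filter] at hp hq hr
      refine zT (p, q, r) ?_ σ w hσ hp.2 hq.2 hr.2 hz
      simp only [J, Finset.coe_filter, Finset.mem_product, mem_ofPred_eq]
      exact ⟨⟨hp.1, hq.1, hr.1⟩, hpq, hpr, hqr⟩
    · exact hE.boundary σ w hσ

/-- Every finite set can be perturbed into general position. -/
lemma IsSmoothGauge.exists_perturbation {φ : Pt → ℝ} (hφ : IsSmoothGauge φ) (X : Finset Pt)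
    {U : Pt → Set Pt} (hU : ∀ x ∈ X, U x ∈ nhds x) :
    ∃ E : Pt → Pt, (∀ x ∈ X, E x ∈ U x) ∧ Set.InjOn E X ∧
      ∃ X' : Finset Pt, (X' : Set Pt) = E '' X ∧ GeneralPosition φ X' := by
  classical
  induction X using Finset.induction_on with
  | empty => exact ⟨id, by simp, by simp, ∅, by simp, ⟨by simp, by simp, by simp⟩⟩
  | insert a X ha ih =>
    obtain ⟨E, hEU, hinj, X', hX', hgen⟩ := ih fun x hx => hU x (Finset.mem_insert_of_mem hx)
    obtain ⟨z, ⟨hz, hzgen⟩, hzU⟩ := (hgen.dense_insert hφ).inter_nhds_nonempty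
      (hU a (Finset.mem_insert_self a X))
    have hne : ∀ x ∈ X, x ≠ a := fun x hx h => ha (h ▸ hx)
    have himg : Function.update E a z '' X = E '' X :=
      image_congr fun x hx => Function.update_of_ne (hne x hx) _ _
    refine ⟨Function.update E a z, ?_, ?_, insert z X', ?_, hzgen⟩
    · intro x hx
      rcases Finset.mem_insert.1 hx with rfl | hx
      · simpa using hzU
      · rw [Function.update_of_ne (hne x hx)]
        exact hEU x hx
    · rw [Finset.coe_insert, Set.injOn_insert (by simpa using ha), himg, Function.update_self,
        ← hX']
      refine ⟨hinj.congr fun x hx => (Function.update_of_ne (hne x hx) _ _).symm, hz⟩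
    · rw [Finset.coe_insert, Finset.coe_insert, image_insert_eq, himg, Function.update_self, hX']

/-- A nonempty compact convex set can be separated from finitely many points by a smooth gauge. -/
lemma exists_isSmoothGauge {S : Set Pt} (hne : S.Nonempty) (hconv : Convex ℝ S)
    (hcomp : IsCompact S) (F : Finset Pt) (hF : ∀ x ∈ F, x ∉ S) :
    ∃ φ : Pt → ℝ, IsSmoothGauge φ ∧ (∀ x, 0 ≤ φ x) ∧ (∀ x ∈ S, φ x < 1) ∧ ∀ x ∈ F, 1 < φ x := by
  classical
  induction F using Finset.induction_on with
  | empty =>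
    obtain ⟨R, hR0, hR⟩ := hcomp.isBounded.exists_pos_norm_lt
    have hS : ∀ x ∈ S, (R ^ 2)⁻¹ * ‖x‖ ^ 2 < 1 := by
      intro x hx
      rw [inv_mul_lt_iff₀ (by positivity), mul_one]
      have := hR x hx
      gcongr
    refine ⟨fun x => (R ^ 2)⁻¹ * ‖x‖ ^ 2, ⟨?_, ?_, ⟨R, ?_⟩, ?_⟩, fun x => by positivity, hS, by simp⟩
    · exact contDiff_const.mul (contDiff_norm_sq ℝ)
    · refine StrongConvexOn.strictConvexOn (m := 2 * (R ^ 2)⁻¹) ?_ (by positivity)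
      rw [strongConvexOn_iff_convex]
      have : (fun x : Pt => (R ^ 2)⁻¹ * ‖x‖ ^ 2 - 2 * (R ^ 2)⁻¹ / 2 * ‖x‖ ^ 2) = fun _ => 0 := by
        ext x
        ring
      rw [this]
      exact convexOn_const 0 convex_univ
    · intro x hx
      rw [inv_mul_le_iff₀ (by positivity), mul_one] at hx
      exact le_of_sq_le_sq hx hR0.le
    · obtain ⟨x, hx⟩ := hne
      exact ⟨x, hS x hx⟩
  | insert a F ha ih =>
    obtain ⟨φ, hφ, hpos, hS, hF'⟩ := ih fun x hx => hF x (Finset.mem_insert_of_mem hx)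
    obtain ⟨f, u, hfu, hua⟩ := geometric_hahn_banach_closed_point hconv hcomp.isClosed
      (hF a (Finset.mem_insert_self a F))
    obtain ⟨z, hzS, hz⟩ := hcomp.exists_isMaxOn hne hφ.contDiff.continuous.continuousOn
    obtain ⟨y, hyS, hy⟩ := hcomp.exists_isMaxOn hne f.continuous.continuousOn
    have hlim : Filter.Tendsto (fun N : ℝ => Real.exp (N * (f y - u))) Filter.atTop (nhds 0) :=
      Real.tendsto_exp_atBot.comp
        (Filter.tendsto_id.atTop_mul_const_of_neg (sub_neg.2 (hfu y hyS)))
    obtain ⟨N, hN, hN0⟩ := ((hlim.eventually (gt_mem_nhds (sub_pos.2 (hS z hzS)))).and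
      (Filter.eventually_gt_atTop 0)).exists
    have hSψ : ∀ x ∈ S, φ x + Real.exp (N * (f x - u)) < 1 := by
      intro x hx
      have h1 : φ x ≤ φ z := hz hx
      have h2 : f x ≤ f y := hy hx
      have h3 : Real.exp (N * (f x - u)) ≤ Real.exp (N * (f y - u)) := by gcongr
      linarith
    refine ⟨fun x => φ x + Real.exp (N * (f x - u)), ⟨?_, ?_, ?_, ?_⟩,
      fun x => add_nonneg (hpos x) (Real.exp_pos _).le, hSψ, ?_⟩
    · exact hφ.contDiff.add (Real.contDiff_exp.comp
        (contDiff_const.mul (f.contDiff.sub contDiff_const)))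
    · refine hφ.strictConvex.add_convexOn ⟨convex_univ, fun x _ y _ s t hs ht hst => ?_⟩
      have := convexOn_exp.2 (mem_univ (N * (f x - u))) (mem_univ (N * (f y - u))) hs ht hst
      convert this using 2
      simp only [map_add, map_smul, smul_eq_mul]
      linear_combination N * u * hst
    · obtain ⟨r, hr⟩ := hφ.bounded
      exact ⟨r, fun x hx => hr x (by linarith [Real.exp_pos (N * (f x - u))])⟩
    · obtain ⟨x, hx⟩ := hne
      exact ⟨x, hSψ x hx⟩
    · intro x hx
      rcases Finset.mem_insert.1 hx with rfl | hxF
      · have := Real.one_lt_exp_iff.2 (mul_pos hN0 (sub_pos.2 hua))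
        linarith [hpos x]
      · linarith [hF' x hxF, Real.exp_pos (N * (f x - u))]

/-- The bound for strictly captured sets and strictly separated sets of arbitrary points. -/
lemma card_strictly_captured_add_card_separated_le {φ : Pt → ℝ} (hφ : IsSmoothGauge φ)
    {X : Finset Pt} {m : ℕ} (hm : 1 ≤ m) (hmX : m < X.card) {𝓕 𝓗 : Finset (Finset Pt)}
    (h𝓕 : ∀ Y ∈ 𝓕, Y ⊆ X ∧ Y.card = m + 1 ∧ ∃ (σ : ℝ) (w : Pt), 0 < σ ∧
      (∀ y ∈ Y, φ (σ • y + w) < 1) ∧ ∀ x ∈ X, x ∉ Y → 1 < φ (σ • x + w))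
    (h𝓗 : ∀ H ∈ 𝓗, H ⊆ X ∧ H.Nonempty ∧ H.card ≤ m ∧ ∃ α β a : ℝ,
      (∀ h ∈ H, α * h 0 + β * h 1 < a) ∧ ∀ x ∈ X, x ∉ H → a < α * x 0 + β * x 1) :
    𝓕.card + 𝓗.card + m * (m + 1) ≤ (X.card - m) + 2 * m * X.card := by
  classical
  choose! h𝓕X h𝓕m σ w hσ hin hout using h𝓕
  choose! h𝓗X h𝓗ne h𝓗m α β a hlt hgt using h𝓗
  have hcont : Continuous φ := hφ.contDiff.continuous
  have hU : ∀ x ∈ X, {z : Pt | (∀ Y ∈ 𝓕, (x ∈ Y → φ (σ Y • z + w Y) < 1) ∧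
      (x ∉ Y → 1 < φ (σ Y • z + w Y))) ∧ ∀ H ∈ 𝓗, (x ∈ H → α H * z 0 + β H * z 1 < a H) ∧
      (x ∉ H → a H < α H * z 0 + β H * z 1)} ∈ nhds x := by
    intro x hx
    refine Filter.Eventually.and ?_ ?_
    · rw [Filter.eventually_all_finset]
      intro Y hY
      have hc : ContinuousAt (fun z : Pt => φ (σ Y • z + w Y)) x := by fun_prop
      refine Filter.Eventually.and ?_ ?_
      · exact Filter.eventually_imp_distrib_left.2 fun h => hc.eventually_lt_const (hin Y hY x h)
      · exact Filter.eventually_imp_distrib_left.2 fun h =>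
          hc.eventually_const_lt (hout Y hY x hx h)
    · rw [Filter.eventually_all_finset]
      intro H hH
      have hc : ContinuousAt (fun z : Pt => α H * z 0 + β H * z 1) x := by fun_prop
      refine Filter.Eventually.and ?_ ?_
      · exact Filter.eventually_imp_distrib_left.2 fun h => hc.eventually_lt_const (hlt H hH x h)
      · exact Filter.eventually_imp_distrib_left.2 fun h =>
          hc.eventually_const_lt (hgt H hH x hx h)
  obtain ⟨E, hE, hinj, X', hX', hgen⟩ := hφ.exists_perturbation X hU
  obtain rfl : X' = X.image E := Finset.coe_injective (by rw [hX', Finset.coe_image])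
  have hcard : (X.image E).card = X.card := Finset.card_image_of_injOn hinj
  have himage : ∀ {𝓖 : Finset (Finset Pt)}, (∀ Y ∈ 𝓖, Y ⊆ X) →
      (𝓖.image (Finset.image E)).card = 𝓖.card := by
    intro 𝓖 h𝓖
    refine Finset.card_image_of_injOn fun Y hY Y' hY' he => Finset.coe_injective ?_
    have he' : E '' (Y : Set Pt) = E '' (Y' : Set Pt) := by
      rw [← Finset.coe_image, ← Finset.coe_image]
      exact congrArg _ he
    exact (hinj.image_eq_image_iff (Finset.coe_subset.2 (h𝓖 Y hY))
      (Finset.coe_subset.2 (h𝓖 Y' hY'))).1 he'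
  have hsub : ∀ {Y : Finset Pt}, Y ⊆ X → (Y.image E).card = Y.card := fun hY =>
    Finset.card_image_of_injOn (hinj.mono (Finset.coe_subset.2 hY))
  have key := card_captured_add_card_separated_le hφ hgen hm (by rwa [hcard])
    (𝓕 := 𝓕.image (Finset.image E)) (𝓗 := 𝓗.image (Finset.image E)) ?_ ?_
  · rwa [himage h𝓕X, himage h𝓗X, hcard] at key
  · intro Y' hY'
    obtain ⟨Y, hY, rfl⟩ := Finset.mem_image.1 hY'
    refine ⟨Finset.image_subset_image (h𝓕X Y hY), by rw [hsub (h𝓕X Y hY), h𝓕m Y hY], σ Y, w Y,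
      hσ Y hY, ?_, ?_⟩
    · rw [Finset.forall_mem_image]
      exact fun y hy => (((hE y (h𝓕X Y hY hy)).1 Y hY).1 hy).le
    · rw [Finset.forall_mem_image]
      exact fun x hx hxY =>
        (((hE x hx).1 Y hY).2 fun h => hxY (Finset.mem_image_of_mem E h)).le
  · intro H' hH'
    obtain ⟨H, hH, rfl⟩ := Finset.mem_image.1 hH'
    refine ⟨Finset.image_subset_image (h𝓗X H hH), (h𝓗ne H hH).image E,
      by rw [hsub (h𝓗X H hH)]; exact h𝓗m H hH, α H, β H, ?_⟩
    rw [SeparatedBy, Finset.forall_mem_image]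
    intro h hh
    rw [Finset.forall_mem_image]
    intro x hx hxH
    exact (((hE h (h𝓗X H hH hh)).2 H hH).1 hh).trans
      (((hE x hx).2 H hH).2 fun h => hxH (Finset.mem_image_of_mem E h))

open Classical in
lemma ncard_eq_card_filter_powerset {X : Finset Pt} {𝓢 : Set (Set Pt)}
    (h : ∀ Y ∈ 𝓢, Y ⊆ (X : Set Pt)) :
    𝓢.ncard = (X.powerset.filter fun Y : Finset Pt => (Y : Set Pt) ∈ 𝓢).card := by
  have : 𝓢 = (fun Y : Finset Pt => (Y : Set Pt)) ''
      (X.powerset.filter fun Y : Finset Pt => (Y : Set Pt) ∈ 𝓢 : Finset (Finset Pt)) := by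
    ext Y
    constructor
    · intro hY
      have hfin : Y.Finite := X.finite_toSet.subset (h Y hY)
      refine ⟨hfin.toFinset, ?_, hfin.coe_toFinset⟩
      rw [Finset.mem_coe, Finset.mem_filter, Finset.mem_powerset, hfin.coe_toFinset]
      exact ⟨fun x hx => h Y hY (hfin.mem_toFinset.1 hx), hY⟩
    · rintro ⟨Y, hY, rfl⟩
      exact (Finset.mem_filter.1 hY).2
  conv_lhs => rw [this]
  rw [Set.ncard_image_of_injective _ Finset.coe_injective, Set.ncard_coe_finset]

lemma exists_preimage_homothety_of_isRange {S T : Set Pt} (h : IsRange S T) :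
    ∃ (σ : ℝ) (w : Pt), 0 < σ ∧ ∀ x, x ∈ T ↔ σ • x + w ∈ S := by
  obtain ⟨c, v, hc, rfl⟩ := h
  refine ⟨c⁻¹, -(c⁻¹ • v), inv_pos.2 hc, fun x => ?_⟩
  constructor
  · rintro ⟨y, hy, rfl⟩
    simpa [smul_smul, hc.ne'] using hy
  · intro hx
    refine ⟨_, hx, ?_⟩
    simp [smul_smul, hc.ne']

lemma exists_strict_separation_of_isClosedHalfplane {X H : Finset Pt} {T : Set Pt}
    (hT : IsClosedHalfplane T) (h : (X : Set Pt) ∩ T = H) :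
    ∃ α β a : ℝ, (∀ h ∈ H, α * h 0 + β * h 1 < a) ∧ ∀ x ∈ X, x ∉ H → a < α * x 0 + β * x 1 := by
  obtain ⟨f, a, -, rfl⟩ := hT
  have hf : ∀ x, f xDir * x 0 + f yDir * x 1 = f x := fun x => by
    conv_rhs => rw [Pt.decomp x]
    simp [mul_comm]
  have hmem : ∀ x ∈ X, x ∈ H ↔ f x ≤ a := fun x hx => by
    rw [← Finset.mem_coe, ← h]
    simp [hx]
  have hHX : ∀ x ∈ H, x ∈ X := fun x hx => by
    rw [← Finset.mem_coe, ← h] at hx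
    exact hx.1
  have hev : ∀ᶠ b in nhdsWithin a (Ioi a), ∀ x ∈ X, x ∉ H → b < f x := by
    rw [Filter.eventually_all_finset]
    intro x hx
    refine Filter.eventually_imp_distrib_left.2 fun hxH => ?_
    rw [hmem x hx, not_le] at hxH
    exact Filter.Eventually.filter_mono nhdsWithin_le_nhds (gt_mem_nhds hxH)
  obtain ⟨b, hb, hab⟩ := (hev.and self_mem_nhdsWithin).exists
  refine ⟨f xDir, f yDir, b, fun x hx => ?_, fun x hx hxH => ?_⟩
  · rw [hf]
    exact ((hmem x (hHX x hx)).1 hx).trans_lt hab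
  · rw [hf]
    exact hb x hx hxH

/-- the number of hyperedges of the `k`-uniform `S`-capturing
hypergraph is at most `(2k−1)|X| − k² + 1 − ∑_{i=1}^{k−1} aᵢ`. -/
theorem capturing_hypergraph_density_upper_bound
    (S : Set Pt) (hconv : Convex ℝ S) (hcomp : IsCompact S)
    (X : Finset Pt) (k : ℕ) (hk : 1 ≤ k) (hkX : k ≤ X.card) :
    ((capturedSets S X k).ncard : ℤ) ≤
      (2 * (k : ℤ) - 1) * X.card - (k : ℤ) ^ 2 + 1 -
        ∑ i ∈ Finset.Icc 1 (k - 1), ((iSets X i).ncard : ℤ) := by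
  classical
  rw [ncard_eq_card_filter_powerset (fun Y hY => hY.1)]
  simp only [ncard_eq_card_filter_powerset (X := X) (𝓢 := iSets X _) (fun Y hY => hY.1)]
  set 𝓕 := X.powerset.filter fun Y : Finset Pt => (Y : Set Pt) ∈ capturedSets S X k with h𝓕
  have h𝓕k : ∀ Y ∈ 𝓕, Y ⊆ X ∧ Y.card = k := by
    intro Y hY
    obtain ⟨hYX, -, hYk, -⟩ := Finset.mem_filter.1 hY
    exact ⟨Finset.mem_powerset.1 hYX, by rwa [Set.ncard_coe_finset] at hYk⟩
  obtain ⟨m, rfl⟩ : ∃ m, k = m + 1 := ⟨k - 1, by omega⟩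
  rcases Nat.eq_zero_or_pos m with rfl | hm
  · have h1 : 𝓕 ⊆ Finset.powersetCard 1 X := fun Y hY => Finset.mem_powersetCard.2 (h𝓕k Y hY)
    have h2 := Finset.card_le_card h1
    rw [Finset.card_powersetCard, Nat.choose_one_right] at h2
    simpa using h2
  rw [Nat.add_sub_cancel]
  set A : ℕ → Finset (Finset Pt) := fun i =>
    X.powerset.filter fun Y : Finset Pt => (Y : Set Pt) ∈ iSets X i with hA
  have hAmem : ∀ i, ∀ H ∈ A i, H ⊆ X ∧ H.card = i ∧ ∃ α β a : ℝ,
      (∀ h ∈ H, α * h 0 + β * h 1 < a) ∧ ∀ x ∈ X, x ∉ H → a < α * x 0 + β * x 1 := by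
    intro i H hH
    obtain ⟨hHX, -, hHi, T, hT, hTH⟩ := Finset.mem_filter.1 hH
    exact ⟨Finset.mem_powerset.1 hHX, by rwa [Set.ncard_coe_finset] at hHi,
      exists_strict_separation_of_isClosedHalfplane hT hTH⟩
  have hsum : ((Finset.Icc 1 m).biUnion A).card = ∑ i ∈ Finset.Icc 1 m, (A i).card := by
    refine Finset.card_biUnion fun i _ j _ hij => Finset.disjoint_left.2 fun H hi hj => hij ?_
    rw [← (hAmem i H hi).2.1, ← (hAmem j H hj).2.1]
  have hrange : ∀ Y ∈ 𝓕, ∃ (σ : ℝ) (w : Pt), 0 < σ ∧ ∀ x ∈ X, x ∈ Y ↔ σ • x + w ∈ S := by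
    intro Y hY
    obtain ⟨-, -, -, T, hT, hTY⟩ := Finset.mem_filter.1 hY
    obtain ⟨σ, w, hσ, h⟩ := exists_preimage_homothety_of_isRange hT
    refine ⟨σ, w, hσ, fun x hx => ?_⟩
    rw [← Finset.mem_coe, ← hTY, ← h]
    simp [hx]
  choose! σ w hσ hmem using hrange
  obtain ⟨φ, hφ, hin, hout⟩ : ∃ φ, IsSmoothGauge φ ∧
      (∀ Y ∈ 𝓕, ∀ x ∈ Y, φ (σ Y • x + w Y) < 1) ∧
      ∀ Y ∈ 𝓕, ∀ x ∈ X, x ∉ Y → 1 < φ (σ Y • x + w Y) := by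
    rcases S.eq_empty_or_nonempty with rfl | hne
    · obtain ⟨φ, hφ, -⟩ := exists_isSmoothGauge (singleton_nonempty (0 : Pt))
        (convex_singleton 0) isCompact_singleton ∅ (by simp)
      have hno : ∀ Y ∈ 𝓕, False := by
        intro Y hY
        obtain ⟨hYX, hYk⟩ := h𝓕k Y hY
        obtain ⟨y, hy⟩ := Finset.card_pos.1 (show 0 < Y.card by omega)
        exact (hmem Y hY y (hYX hy)).1 hy
      exact ⟨φ, hφ, fun Y hY => (hno Y hY).elim, fun Y hY => (hno Y hY).elim⟩
    · obtain ⟨φ, hφ, -, hS, hF⟩ := exists_isSmoothGauge hne hconv hcomp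
        (𝓕.biUnion fun Y => (X \ Y).image fun x => σ Y • x + w Y) (by
          intro z hz
          obtain ⟨Y, hY, hz⟩ := Finset.mem_biUnion.1 hz
          obtain ⟨x, hx, rfl⟩ := Finset.mem_image.1 hz
          obtain ⟨hxX, hxY⟩ := Finset.mem_sdiff.1 hx
          rwa [← hmem Y hY x hxX])
      refine ⟨φ, hφ, fun Y hY x hx => hS _ ((hmem Y hY x ((h𝓕k Y hY).1 hx)).1 hx),
        fun Y hY x hx hxY => hF _ ?_⟩
      exact Finset.mem_biUnion.2 ⟨Y, hY, Finset.mem_image_of_mem _ (Finset.mem_sdiff.2 ⟨hx, hxY⟩)⟩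
  have key := card_strictly_captured_add_card_separated_le hφ hm (show m < X.card by omega)
    (𝓕 := 𝓕) (𝓗 := (Finset.Icc 1 m).biUnion A)
    (fun Y hY => ⟨(h𝓕k Y hY).1, (h𝓕k Y hY).2, σ Y, w Y, hσ Y hY, hin Y hY, hout Y hY⟩)
    (by
      intro H hH
      obtain ⟨i, hi, hHi⟩ := Finset.mem_biUnion.1 hH
      obtain ⟨hHX, rfl, hsep⟩ := hAmem i H hHi
      obtain ⟨h1, h2⟩ := Finset.mem_Icc.1 hi
      exact ⟨hHX, Finset.card_pos.1 h1, h2, hsep⟩)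
  rw [hsum] at key
  zify [show m ≤ X.card by omega] at key
  push_cast
  linarith
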